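/- arXiv:math/0601729 — 4 statements merged into one kernel-verified Lean document; each statement's English description precedes it below -/
import Mathlib

section
/- The function h(w) = -a/w + b/(w-2) + ∑_{k ∈ ℤ} c_k/(w - u_k), with a = 1/(2(e^{-1}+1)), b = 1/(2(e+1)), c_k = 1/((2k+1)²π²+1), u_k = 1 + (2k+1)πi, defines a meromorphic function on ℂ which equals g(w) = 1/(w(w-2)(e^{w-1}+1)) identically. -/
open Complex Filter Real

open scoped Topology

/-- Symmetric partial sums of the half-integer poles are those of the cotangent series, up to
one boundary term. -/
lemma sum_range_half_integer_poles_eq_cotTerm (z : ℂ) (N : ℕ) :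
    ∑ n ∈ Finset.range N, (1 / (z - (n + 1)) + 1 / (z + n)) =
      1 / z + ∑ n ∈ Finset.range N, cotTerm z n - 1 / (z + N) := by
  induction N with
  | zero => simp
  | succ N ih =>
    rw [Finset.sum_range_succ, Finset.sum_range_succ, ih, cotTerm]
    push_cast
    ring

lemma tendsto_sum_range_half_integer_poles {z : ℂ} (hz : z ∈ integerComplement) :
    Tendsto (fun N : ℕ => ∑ n ∈ Finset.range N, (1 / (z - (n + 1)) + 1 / (z + n))) atTop
      (𝓝 (π * Complex.cot (π * z))) := by
  have h0 : Tendsto (fun N : ℕ => 1 / (z + N)) atTop (𝓝 0) := by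
    simp only [one_div]
    refine tendsto_inv₀_cobounded.comp ?_
    exact (tendsto_const_add_cobounded z).comp tendsto_natCast_atTop_cobounded
  have h1 := ((tendsto_logDeriv_euler_cot_sub hz).const_add (1 / z)).sub h0
  simp_rw [sum_range_half_integer_poles_eq_cotTerm]
  convert h1 using 2
  ring

/-- Partial fractions of the Fermi function `1 / (exp s + 1)`. -/
lemma tendsto_sum_range_fermi_poles {s : ℂ} (hs : Complex.exp s + 1 ≠ 0) :
    Tendsto (fun N : ℕ => ∑ n ∈ Finset.range N,
        (1 / (s - (2 * n + 1) * π * I) + 1 / (s + (2 * n + 1) * π * I))) atTop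
      (𝓝 (1 / 2 - 1 / (Complex.exp s + 1))) := by
  have hpi : (π : ℂ) ≠ 0 := by exact_mod_cast Real.pi_ne_zero
  have hI : I ≠ 0 := I_ne_zero
  obtain ⟨z, hz⟩ : ∃ z : ℂ, s = 2 * π * I * z - π * I := by
    refine ⟨(s + π * I) / (2 * π * I), ?_⟩
    field_simp
    ring
  have hexp : Complex.exp (2 * π * I * z) = -Complex.exp s := by
    rw [hz, Complex.exp_sub, Complex.exp_pi_mul_I]
    ring
  have hzc : z ∈ integerComplement := by
    rintro ⟨m, rfl⟩
    apply hs
    have : Complex.exp (2 * π * I * m) = 1 := by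
      rw [mul_comm]
      exact Complex.exp_int_mul_two_pi_mul_I m
    rw [this] at hexp
    linear_combination hexp
  have h := (tendsto_sum_range_half_integer_poles hzc).const_mul (1 / (2 * π * I))
  convert h using 2
  · rw [Finset.mul_sum]
    refine Finset.sum_congr rfl fun n _ => ?_
    have h1 : s - (2 * n + 1) * π * I = 2 * π * I * (z - (n + 1)) := by rw [hz]; ring
    have h2 : s + (2 * n + 1) * π * I = 2 * π * I * (z + n) := by rw [hz]; ring
    rw [h1, h2, one_div_mul_eq_div, add_div, div_div, div_div, mul_comm (z - _), mul_comm (z + _)]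
  · have hE : Complex.exp (2 * I * (π * z)) = -Complex.exp s := by
      rw [← hexp]; congr 1; ring
    have hs' : 1 + Complex.exp s ≠ 0 := by rwa [add_comm]
    rw [Complex.cot_eq_exp_ratio, hE, sub_neg_eq_add]
    field_simp
    rw [I_sq]
    ring

lemma summable_inv_odd_sq_mul_pi_sq_add_one :
    Summable fun k : ℤ => ((2 * (k : ℝ) + 1) ^ 2 * π ^ 2 + 1)⁻¹ := by
  have hsum : Summable fun k : ℤ => 1 / (k : ℝ) ^ 2 :=
    Real.summable_one_div_int_pow.mpr one_lt_two
  refine hsum.of_norm_bounded_eventually ?_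
  filter_upwards [(Set.finite_singleton (0 : ℤ)).compl_mem_cofinite] with k hk
  have hk0 : (k : ℝ) ≠ 0 := by exact_mod_cast hk
  rw [Real.norm_of_nonneg (by positivity), ← one_div]
  have h1 : (k : ℝ) ^ 2 ≤ (2 * (k : ℝ) + 1) ^ 2 := by
    have : k ^ 2 ≤ (2 * k + 1) ^ 2 := by
      rcases le_or_gt 0 k with h | h
      · nlinarith
      · nlinarith [mul_nonneg (by omega : 0 ≤ -(3 * k + 1)) (by omega : 0 ≤ -(k + 1))]
    exact_mod_cast this
  have h2 : 1 ≤ π ^ 2 := by nlinarith [Real.pi_gt_three]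
  gcongr
  nlinarith [mul_nonneg (sq_nonneg (2 * (k : ℝ) + 1)) (sub_nonneg.mpr h2)]

lemma summable_inv_odd_sq_div_sub (s : ℂ) :
    Summable fun k : ℤ =>
      (((2 * (k : ℝ) + 1) ^ 2 * π ^ 2 + 1 : ℝ) : ℂ)⁻¹ / (s - (2 * k + 1) * π * I) := by
  refine summable_inv_odd_sq_mul_pi_sq_add_one.of_norm_bounded_eventually ?_
  have hfin : {k : ℤ | |(k : ℝ)| ≤ ‖s‖ + 2}.Finite := by
    refine (Set.finite_Icc (-⌈‖s‖ + 2⌉) ⌈‖s‖ + 2⌉).subset fun k hk => ?_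
    have hk : |(k : ℝ)| ≤ ‖s‖ + 2 := hk
    have h := abs_le.mp (hk.trans (Int.le_ceil _))
    exact ⟨by exact_mod_cast h.1, by exact_mod_cast h.2⟩
  filter_upwards [hfin.compl_mem_cofinite] with k hk
  have hk : ‖s‖ + 2 < |(k : ℝ)| := not_le.mp hk
  have hnorm : ‖(2 * k + 1) * π * I‖ = |2 * (k : ℝ) + 1| * π := by
    have : ((2 * k + 1) * π * I : ℂ) = ((2 * (k : ℝ) + 1 : ℝ) : ℂ) * (π : ℝ) * I := by
      push_cast; ring
    rw [this, norm_mul, norm_mul, Complex.norm_real, Complex.norm_real, Complex.norm_I,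
      Real.norm_eq_abs, Real.norm_of_nonneg Real.pi_pos.le, mul_one]
  have habs : |(k : ℝ)| - 1 ≤ |2 * (k : ℝ) + 1| := by
    rcases abs_cases (k : ℝ) with h | h <;> rcases abs_cases (2 * (k : ℝ) + 1) with h' | h' <;>
      linarith
  have hle : 1 ≤ ‖s - (2 * k + 1) * π * I‖ := by
    have h1 := norm_sub_norm_le ((2 * k + 1) * π * I) s
    rw [hnorm, norm_sub_rev] at h1
    nlinarith [Real.pi_gt_three, abs_nonneg (2 * (k : ℝ) + 1)]
  rw [norm_div, norm_inv, Complex.norm_real, Real.norm_of_nonneg (by positivity)]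
  exact div_le_self (by positivity) hle

lemma exp_one_add_one_ne_zero : Complex.exp 1 + 1 ≠ 0 := by
  rw [← Complex.ofReal_one, ← Complex.ofReal_exp, ← Complex.ofReal_add]
  exact Complex.ofReal_ne_zero.mpr (by positivity)

lemma inv_sq_add_one_div_pair {s y : ℂ} (hy : y ^ 2 + 1 ≠ 0) (h1 : s ^ 2 - 1 ≠ 0)
    (hm : s - y * I ≠ 0) (hp : s + y * I ≠ 0) :
    (s * (1 / (1 - y * I) + 1 / (1 + y * I)) - (1 / (s - y * I) + 1 / (s + y * I))) /
        (s ^ 2 - 1) = (y ^ 2 + 1)⁻¹ / (s - y * I) + (y ^ 2 + 1)⁻¹ / (s + y * I) := by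
  have hfac : (1 - y * I) * (1 + y * I) = y ^ 2 + 1 := by linear_combination -y ^ 2 * I_sq
  have hq : (1 - y * I) * (1 + y * I) ≠ 0 := by rwa [hfac]
  have hq1 := left_ne_zero_of_mul hq
  have hq2 := right_ne_zero_of_mul hq
  rw [← hfac]
  field_simp
  ring

lemma tsum_inv_odd_sq_div_sub {s : ℂ} (hs : Complex.exp s + 1 ≠ 0) (h1 : s ^ 2 - 1 ≠ 0)
    (hpole : ∀ k : ℤ, s - (2 * k + 1) * π * I ≠ 0) :
    ∑' k : ℤ, (((2 * (k : ℝ) + 1) ^ 2 * π ^ 2 + 1 : ℝ) : ℂ)⁻¹ / (s - (2 * k + 1) * π * I) =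
      (s * (1 / 2 - 1 / (Complex.exp 1 + 1)) - (1 / 2 - 1 / (Complex.exp s + 1))) /
        (s ^ 2 - 1) := by
  have he := exp_one_add_one_ne_zero
  have hsum := (summable_inv_odd_sq_div_sub s).hasSum.nat_add_neg_add_one.tendsto_sum_nat
  have hlim := (((tendsto_sum_range_fermi_poles he).const_mul s).sub
    (tendsto_sum_range_fermi_poles hs)).div_const (s ^ 2 - 1)
  refine tendsto_nhds_unique hsum (hlim.congr fun N => ?_)
  rw [Finset.mul_sum, ← Finset.sum_sub_distrib, Finset.sum_div]
  refine Finset.sum_congr rfl fun n _ => ?_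
  have hp := hpole (-(n + 1))
  have hy : ((2 * (n : ℂ) + 1) * π) ^ 2 + 1 ≠ 0 := by
    have : ((2 * (n : ℝ) + 1) * π) ^ 2 + 1 ≠ 0 := by positivity
    exact_mod_cast this
  have hneg : (2 * ((-((n : ℤ) + 1) : ℤ) : ℂ) + 1) = -(2 * n + 1) := by push_cast; ring
  have hnegR : (2 * ((-((n : ℤ) + 1) : ℤ) : ℝ) + 1) = -(2 * n + 1) := by push_cast; ring
  simp only [hneg, hnegR, neg_sq, neg_mul, sub_neg_eq_add] at hp ⊢
  rw [inv_sq_add_one_div_pair hy h1 (by exact_mod_cast hpole n) hp]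
  push_cast
  rw [mul_pow]

/-- The partial fraction expansion: with a = 1/(2(e^{-1}+1)), b = 1/(2(e+1)),
c_k = 1/((2k+1)²π²+1), u_k = 1 + (2k+1)πi, the function
h(w) = -a/w + b/(w-2) + ∑_{k ∈ ℤ} c_k/(w - u_k) is defined (the series converges)
away from the poles and equals g(w) = 1/(w(w-2)(e^{w-1}+1)) there. -/
theorem stmt_7
    (g : ℂ → ℂ) (hg : ∀ w, g w = (w * (w - 2) * (Complex.exp (w - 1) + 1))⁻¹)
    (a b : ℂ) (ha : a = 1 / (2 * (Complex.exp (-1) + 1)))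
    (hb : b = 1 / (2 * (Complex.exp 1 + 1)))
    (c : ℤ → ℂ) (hc : ∀ k, c k = (((2 * (k : ℝ) + 1) ^ 2 * Real.pi ^ 2 + 1 : ℝ) : ℂ)⁻¹)
    (u : ℤ → ℂ) (hu : ∀ k, u k = 1 + (2 * k + 1) * Real.pi * Complex.I) :
    ∀ w : ℂ, w ≠ 0 → w ≠ 2 → (∀ k : ℤ, w ≠ u k) →
      Summable (fun k : ℤ => c k / (w - u k)) ∧
      (-a / w + b / (w - 2) + ∑' k : ℤ, c k / (w - u k)) = g w := by
  intro w hw0 hw2 hwu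
  obtain ⟨s, rfl⟩ : ∃ s : ℂ, w = 1 + s := ⟨w - 1, by ring⟩
  have hpole : ∀ k : ℤ, s - (2 * k + 1) * π * I ≠ 0 := fun k h => by
    apply hwu k
    rw [hu]
    linear_combination h
  have hs : Complex.exp s + 1 ≠ 0 := fun h => by
    have : Complex.exp (s - π * I) = 1 := by
      rw [Complex.exp_sub, Complex.exp_pi_mul_I]
      linear_combination -h
    obtain ⟨k, hk⟩ := Complex.exp_eq_one_iff.mp this
    apply hpole k
    linear_combination hk
  have hp : s + 1 ≠ 0 := by rwa [add_comm]
  have hm : s - 1 ≠ 0 := fun h => hw2 (by linear_combination h)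
  have h1 : s ^ 2 - 1 ≠ 0 := by
    rw [show s ^ 2 - 1 = (s + 1) * (s - 1) by ring]
    exact mul_ne_zero hp hm
  have hterm : (fun k : ℤ => c k / (1 + s - u k)) = fun k : ℤ =>
      (((2 * (k : ℝ) + 1) ^ 2 * π ^ 2 + 1 : ℝ) : ℂ)⁻¹ / (s - (2 * k + 1) * π * I) := by
    funext k
    rw [hc, hu, add_sub_add_left_eq_sub]
  rw [hterm]
  refine ⟨summable_inv_odd_sq_div_sub s, ?_⟩
  have he := exp_one_add_one_ne_zero
  have he' : 1 + Complex.exp 1 ≠ 0 := by rwa [add_comm]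
  have he0 : Complex.exp 1 ≠ 0 := Complex.exp_ne_zero 1
  have ha' : a = Complex.exp 1 / (2 * (Complex.exp 1 + 1)) := by
    rw [ha, Complex.exp_neg]
    field_simp
    ring
  rw [tsum_inv_odd_sq_div_sub hs h1 hpole, hg, ha', hb, add_sub_cancel_left,
    show 1 + s = s + 1 by ring, show s + 1 - 2 = s - 1 by ring,
    show s ^ 2 - 1 = (s + 1) * (s - 1) by ring]
  field_simp
  ring
end

section
/- There exist complex numbers v_k with Re v_k ≥ 1 and |v_k| → ∞, and positive reals d_k with ∑ d_k < ∞, such that the function F(w) = ∑_{k=1}^∞ d_k v_k/(w - v_k) is meromorphic on ℂ and has no zeros in ℂ. -/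
open Complex Filter Real
open scoped Topology

/-- A function with only removable singularities agrees with an entire function near every point,
that point excepted, and at every point where it is continuous. -/
lemma exists_differentiable_of_removable {f : ℂ → ℂ}
    (hf : ∀ c, ∃ g : ℂ → ℂ, AnalyticAt ℂ g c ∧ f =ᶠ[𝓝[≠] c] g) :
    ∃ h : ℂ → ℂ, Differentiable ℂ h ∧ ∀ c, ContinuousAt f c → h c = f c := by
  have hlim : ∀ c, ∃ l, Tendsto f (𝓝[≠] c) (𝓝 l) := fun c ↦ by
    obtain ⟨g, hg, hfg⟩ := hf c
    exact ⟨g c, (hg.continuousAt.tendsto.mono_left nhdsWithin_le_nhds).congr' hfg.symm⟩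
  choose h hh using hlim
  refine ⟨h, fun c ↦ ?_, fun c hc ↦
    tendsto_nhds_unique (hh c) (hc.tendsto.mono_left nhdsWithin_le_nhds)⟩
  obtain ⟨g, hg, hfg⟩ := hf c
  have hc : h c = g c := tendsto_nhds_unique (hh c)
    ((hg.continuousAt.tendsto.mono_left nhdsWithin_le_nhds).congr' hfg.symm)
  have hpunct : ∀ᶠ w in 𝓝[≠] c, h w = g w := by
    filter_upwards [eventually_nhdsNE_eventually_nhds_iff.2 hfg,
      hg.eventually_analyticAt.filter_mono nhdsWithin_le_nhds] with w hw hgw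
    exact tendsto_nhds_unique (hh w)
      ((hgw.continuousAt.tendsto.congr' (hw.mono fun _ hx ↦ hx.symm)).mono_left
        nhdsWithin_le_nhds)
  have hev : h =ᶠ[𝓝 c] g := by
    filter_upwards [eventually_nhdsWithin_iff.1 hpunct] with w hw
    rcases eq_or_ne w c with rfl | hne
    · exact hc
    · exact hw hne
  exact hev.differentiableAt_iff.2 hg.differentiableAt

lemma exists_gap {ι : Type*} {Q : ℂ → ℂ} (hQ : Differentiable ℂ Q) {a : ι → ℂ}
    (ha0 : ∀ i, Q (a i) = 0) (hsimple : ∀ w, Q w = 0 → deriv Q w ≠ 0) (c : ℂ) :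
    ∃ ε > 0, ∀ i, a i ≠ c → ε ≤ ‖a i - c‖ := by
  have hev : ∀ᶠ w in 𝓝[≠] c, Q w ≠ 0 := by
    by_cases hc : Q c = 0
    · exact (hQ c).hasDerivAt.eventually_ne (hsimple c hc)
    · exact ((hQ c).continuousAt.eventually_ne hc).filter_mono nhdsWithin_le_nhds
  obtain ⟨ε, hε, hball⟩ := Metric.eventually_nhds_iff.1 (eventually_nhdsWithin_iff.1 hev)
  refine ⟨ε, hε, fun i hi ↦ ?_⟩
  by_contra! hlt
  exact hball (by rwa [dist_eq_norm]) hi (ha0 i)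

lemma norm_tsum_div_sub_le {ι : Type*} {a r : ι → ℂ} (hr : Summable fun i ↦ ‖r i‖) {δ : ℝ}
    (hδ : 0 < δ) {w : ℂ} (h : ∀ i, δ ≤ ‖w - a i‖) :
    ‖∑' i, r i / (w - a i)‖ ≤ (∑' i, ‖r i‖) / δ := by
  refine tsum_of_norm_bounded (hr.hasSum.div_const δ) fun i ↦ ?_
  rw [norm_div]
  gcongr
  exact h i

lemma summable_div_sub {ι : Type*} {a r : ι → ℂ} (hr : Summable fun i ↦ ‖r i‖) {w : ℂ}
    (hgap : ∃ ε > 0, ∀ i, a i ≠ w → ε ≤ ‖a i - w‖) :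
    Summable fun i ↦ r i / (w - a i) := by
  obtain ⟨ε, hε, h⟩ := hgap
  refine Summable.of_norm_bounded (hr.div_const ε) fun i ↦ ?_
  rcases eq_or_ne (a i) w with hi | hi
  · simp only [hi, sub_self, div_zero, norm_zero]
    positivity
  · rw [norm_div, norm_sub_rev w]
    gcongr
    exact h i hi

lemma analyticAt_tsum_div_sub {ι : Type*} {a r : ι → ℂ} (hr : Summable fun i ↦ ‖r i‖) {c : ℂ}
    (hgap : ∃ ε > 0, ∀ i, a i ≠ c → ε ≤ ‖a i - c‖) :
    AnalyticAt ℂ (fun w ↦ ∑' i, if a i = c then 0 else r i / (w - a i)) c := by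
  obtain ⟨ε, hε, h⟩ := hgap
  have hdist : ∀ i, a i ≠ c → ∀ w ∈ Metric.ball c (ε / 2), ε / 2 ≤ ‖w - a i‖ := by
    intro i hi w hw
    have h1 := h i hi
    rw [Metric.mem_ball, dist_eq_norm] at hw
    have h2 : ‖a i - c‖ ≤ ‖w - a i‖ + ‖w - c‖ := by
      rw [norm_sub_rev w (a i)]
      simpa using norm_add_le (a i - w) (w - c)
    linarith
  refine DifferentiableOn.analyticAt (s := Metric.ball c (ε / 2)) ?_
    (Metric.ball_mem_nhds c (by positivity))
  refine differentiableOn_tsum_of_summable_norm (hr.div_const (ε / 2)) (fun i ↦ ?_)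
    Metric.isOpen_ball fun i w hw ↦ ?_
  · by_cases hi : a i = c
    · simp [hi]
    · simp only [hi, if_false]
      intro w hw
      have : w - a i ≠ 0 := by
        rw [← norm_pos_iff]
        linarith [hdist i hi w hw]
      exact DifferentiableAt.differentiableWithinAt (by fun_prop (disch := assumption))
  · by_cases hi : a i = c
    · simp only [hi, if_true, norm_zero]
      positivity
    · simp only [hi, if_false, norm_div]
      gcongr
      exact hdist i hi w hw

/-- The reciprocal of an entire function with simple zeros differs from the sum of its principal
parts by an entire function. -/
lemma exists_entire_eq_inv_sub_tsum {ι : Type*} {Q : ℂ → ℂ} (hQ : Differentiable ℂ Q)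
    {a r : ι → ℂ} (hr : Summable fun i ↦ ‖r i‖) (hinj : Function.Injective a)
    (hzero : ∀ w, Q w = 0 ↔ ∃ i, a i = w) (hr0 : ∀ i, r i ≠ 0)
    (hderiv : ∀ i, deriv Q (a i) = (r i)⁻¹) :
    ∃ h : ℂ → ℂ, Differentiable ℂ h ∧
      ∀ w, Q w ≠ 0 → h w = (Q w)⁻¹ - ∑' i, r i / (w - a i) := by
  classical
  have hgap := exists_gap hQ (fun i ↦ (hzero _).2 ⟨i, rfl⟩) (fun w hw ↦ by
    obtain ⟨i, rfl⟩ := (hzero w).1 hw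
    rw [hderiv]
    exact inv_ne_zero (hr0 i))
  have hregular : ∀ c, Q c ≠ 0 →
      AnalyticAt ℂ (fun w ↦ (Q w)⁻¹ - ∑' i, r i / (w - a i)) c := by
    intro c hc
    have hne : ∀ i, a i ≠ c := fun i hi ↦ hc ((hzero c).2 ⟨i, hi⟩)
    have := analyticAt_tsum_div_sub hr (hgap c)
    simp only [hne, if_false] at this
    exact ((hQ.analyticAt c).inv hc).sub this
  obtain ⟨h, hh, hfh⟩ := exists_differentiable_of_removable
    (f := fun w ↦ (Q w)⁻¹ - ∑' i, r i / (w - a i)) fun c ↦ by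
      by_cases hc : Q c = 0
      swap
      · exact ⟨_, hregular c hc, .rfl⟩
      obtain ⟨j, rfl⟩ := (hzero c).1 hc
      set q := dslope Q (a j) with hq
      have hqa : AnalyticAt ℂ q (a j) :=
        ((differentiableOn_dslope univ_mem).2 hQ.differentiableOn).analyticAt univ_mem
      have hqj : q (a j) = (r j)⁻¹ := by rw [hq, dslope_same, hderiv]
      have hqinv : AnalyticAt ℂ q⁻¹ (a j) := hqa.inv (by simp [hqj, hr0 j])
      obtain ⟨U, hU, hUd⟩ := hqinv.exists_mem_nhds_analyticOnNhd
      refine ⟨fun w ↦ dslope q⁻¹ (a j) w - ∑' i, if a i = a j then 0 else r i / (w - a i),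
        (((differentiableOn_dslope hU).2 hUd.differentiableOn).analyticAt hU).sub
          (analyticAt_tsum_div_sub hr (hgap (a j))), ?_⟩
      filter_upwards [self_mem_nhdsWithin, hqa.continuousAt.eventually_ne (y := 0)
        (by simp [hqj, hr0 j]) |>.filter_mono nhdsWithin_le_nhds]
        with w hw hqw
      have hwj : w - a j ≠ 0 := sub_ne_zero.2 hw
      have hQw : Q w = (w - a j) * q w := by
        have := sub_smul_dslope Q (a j) w
        rw [hc, sub_zero, smul_eq_mul] at this
        exact this.symm
      simp only [hinj.eq_iff]
      rw [(summable_div_sub hr (hgap w)).tsum_eq_add_tsum_ite j, dslope_of_ne _ hw, slope_def_field,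
        hQw, Pi.inv_apply, Pi.inv_apply, hqj, inv_inv]
      field_simp
      ring
  exact ⟨h, hh, fun w hw ↦ hfh w (hregular w hw).continuousAt⟩

lemma exists_add_arctan_eq (c : ℝ) : ∃ y : ℝ, y + Real.arctan y = c := by
  refine Continuous.surjective (by fun_prop) ?_ ?_ c
  · exact tendsto_atTop_add_right_of_le _ (-(π / 2)) tendsto_id
      fun y ↦ (neg_pi_div_two_lt_arctan y).le
  · exact tendsto_atBot_add_right_of_ge _ (π / 2) tendsto_id
      fun y ↦ (arctan_lt_pi_div_two y).le

/-- The solution `y` of `y + Real.arctan y = π / 2 + k π`. -/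
noncomputable def height (k : ℤ) : ℝ := (exists_add_arctan_eq (π / 2 + k * π)).choose

lemma height_add_arctan (k : ℤ) : height k + Real.arctan (height k) = π / 2 + k * π :=
  (exists_add_arctan_eq _).choose_spec

lemma mul_sin_eq_cos_iff (y : ℝ) : y * Real.sin y = Real.cos y ↔ ∃ k, height k = y := by
  have hs : √(1 + y ^ 2) ≠ 0 := by positivity
  have hcos : Real.cos (y + Real.arctan y) * √(1 + y ^ 2) = Real.cos y - y * Real.sin y := by
    rw [Real.cos_add, Real.cos_arctan, Real.sin_arctan]
    field_simp
  have hmono : StrictMono fun y : ℝ ↦ y + Real.arctan y := strictMono_id.add arctan_strictMono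
  rw [eq_comm, ← sub_eq_zero, ← hcos, mul_eq_zero, or_iff_left hs, Real.cos_eq_zero_iff]
  refine exists_congr fun k ↦ ⟨fun h ↦ hmono.injective ?_, ?_⟩
  · simp only [height_add_arctan, h]
    ring
  · rintro rfl
    rw [height_add_arctan]
    ring

lemma height_injective : Function.Injective height := by
  intro j k h
  have hj := height_add_arctan j
  rw [h, height_add_arctan k] at hj
  have : (k : ℝ) = j := mul_right_cancel₀ pi_pos.ne' (by linarith)
  exact_mod_cast this.symm

/-- The pole `1 + i y` of the zero-free function. -/
noncomputable def pole (k : ℤ) : ℂ := 1 + height k * I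

/-- The coefficient `1 / (4 + 2 y²)` attached to `pole k`. -/
noncomputable def weight (k : ℤ) : ℝ := (4 + 2 * height k ^ 2)⁻¹

lemma pole_re (k : ℤ) : (pole k).re = 1 := by simp [pole]

lemma pole_im (k : ℤ) : (pole k).im = height k := by simp [pole]

lemma pole_injective : Function.Injective pole := fun j k h ↦
  height_injective (by rw [← pole_im, h, pole_im])

lemma weight_pos (k : ℤ) : 0 < weight k := by
  unfold weight
  positivity

lemma summable_weight : Summable weight := by
  refine Summable.of_norm_bounded_eventually (Real.summable_one_div_int_pow.2 one_lt_two) ?_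
  filter_upwards [eventually_cofinite_ne (0 : ℤ)] with k hk
  have hk0 : (0 : ℝ) < (k : ℝ) ^ 2 := by positivity
  rw [Real.norm_of_nonneg (weight_pos k).le, weight, one_div]
  refine inv_anti₀ hk0 ?_
  have h := height_add_arctan k
  have h1 := neg_pi_div_two_lt_arctan (height k)
  have h2 := arctan_lt_pi_div_two (height k)
  have h3 : (k * π - height k) ^ 2 ≤ π ^ 2 := sq_le_sq.2 (by
    rw [abs_of_pos pi_pos, abs_le]
    constructor <;> linarith)
  have h4 : (1 : ℝ) ≤ π ^ 2 := one_le_pow₀ (by linarith [pi_gt_three])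
  refine le_of_mul_le_mul_right (a := π ^ 2) ?_ (by positivity)
  nlinarith [sq_nonneg (k * π - 2 * height k), mul_le_mul_of_nonneg_left h4 (sq_nonneg (height k))]

lemma tendsto_norm_pole : Tendsto (fun k ↦ ‖pole k‖) cofinite atTop := by
  have h : Tendsto (fun k ↦ (weight k)⁻¹) cofinite atTop :=
    tendsto_inv_nhdsGT_zero.comp (tendsto_nhdsWithin_iff.2
      ⟨summable_weight.tendsto_cofinite_zero, .of_forall weight_pos⟩)
  refine tendsto_atTop.2 fun b ↦ ?_
  filter_upwards [h.eventually_ge_atTop (4 + 2 * b ^ 2)] with k hk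
  rw [weight, inv_inv] at hk
  calc b ≤ |b| := le_abs_self b
    _ ≤ |height k| := sq_le_sq.1 (by linarith)
    _ = |(pole k).im| := by rw [pole_im]
    _ ≤ ‖pole k‖ := abs_im_le_norm _

/-- The reciprocal of the zero-free function. -/
noncomputable def denom (w : ℂ) : ℂ := w - 2 - w * cexp (2 * (w - 1))

lemma norm_cexp_two_mul_sub_one (w : ℂ) : ‖cexp (2 * (w - 1))‖ = rexp (2 * (w.re - 1)) := by
  simp [norm_exp]

lemma sq_norm_sub_two (w : ℂ) : ‖w - 2‖ ^ 2 = ‖w‖ ^ 2 - 4 * (w.re - 1) := by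
  rw [Complex.sq_norm, Complex.sq_norm, normSq_apply, normSq_apply]
  simp
  ring

lemma re_eq_one_of_denom_eq_zero {w : ℂ} (hw : denom w = 0) : w.re = 1 := by
  have h : ‖w - 2‖ = ‖w‖ * rexp (2 * (w.re - 1)) := by
    rw [← norm_cexp_two_mul_sub_one, ← norm_mul, sub_eq_zero.1 hw]
  have hsq := sq_norm_sub_two w
  rw [h] at hsq
  by_contra hne
  rcases lt_or_gt_of_ne hne with hlt | hgt
  · have he : rexp (2 * (w.re - 1)) ≤ 1 := Real.exp_le_one_iff.2 (by linarith)
    have := mul_le_of_le_one_right (norm_nonneg w) he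
    nlinarith [norm_nonneg w, Real.exp_pos (2 * (w.re - 1)),
      mul_nonneg (norm_nonneg w) (Real.exp_pos (2 * (w.re - 1))).le]
  · have he : 1 ≤ rexp (2 * (w.re - 1)) := Real.one_le_exp (by linarith)
    have := le_mul_of_one_le_right (norm_nonneg w) he
    nlinarith [norm_nonneg w]

lemma denom_one_add_mul_I (y : ℝ) :
    denom (1 + y * I) = 2 * cexp (y * I) * ((y * Real.sin y - Real.cos y : ℝ) : ℂ) := by
  have h : cexp (2 * (1 + y * I - 1)) = cexp (y * I) ^ 2 := by
    rw [← Complex.exp_nat_mul]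
    congr 1
    push_cast
    ring
  rw [denom, h, Complex.exp_mul_I]
  push_cast
  linear_combination (1 - y * I) * Complex.sin_sq_add_cos_sq (y : ℂ) +
    -(y * I * Complex.sin y ^ 2 + 2 * y * Complex.cos y * Complex.sin y +
      Complex.sin y ^ 2) * I_sq

lemma denom_eq_zero_iff (w : ℂ) : denom w = 0 ↔ ∃ k, pole k = w := by
  have key : ∀ y : ℝ, denom (1 + y * I) = 0 ↔ ∃ k, height k = y := fun y ↦ by
    rw [denom_one_add_mul_I, ← mul_sin_eq_cos_iff, ← sub_eq_zero (a := y * Real.sin y)]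
    simp only [mul_eq_zero, Complex.exp_ne_zero, two_ne_zero, false_or, ofReal_eq_zero]
  constructor
  · intro hw
    have h1 : w = 1 + w.im * I := by
      apply Complex.ext <;> simp [re_eq_one_of_denom_eq_zero hw]
    rw [h1, key] at hw
    obtain ⟨k, hk⟩ := hw
    exact ⟨k, by rw [pole, hk, ← h1]⟩
  · rintro ⟨k, rfl⟩
    exact (key _).2 ⟨k, rfl⟩

lemma differentiable_mul_denom : Differentiable ℂ fun w ↦ w * denom w := by
  unfold denom
  fun_prop

lemma deriv_mul_denom (w : ℂ) :
    deriv (fun w ↦ w * denom w) w =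
      2 * w - 2 - 2 * (w + w ^ 2) * cexp (2 * (w - 1)) := by
  have he : HasDerivAt (fun w ↦ cexp (2 * (w - 1))) (cexp (2 * (w - 1)) * (2 * 1)) w :=
    (((hasDerivAt_id w).sub_const 1).const_mul 2).cexp
  have := (hasDerivAt_id w).mul (((hasDerivAt_id w).sub_const 2).sub ((hasDerivAt_id w).mul he))
  refine (this.congr_deriv ?_).deriv
  simp
  ring

lemma deriv_mul_denom_pole (k : ℤ) :
    deriv (fun w ↦ w * denom w) (pole k) = (weight k : ℂ)⁻¹ := by
  have h : denom (pole k) = 0 := (denom_eq_zero_iff _).2 ⟨k, rfl⟩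
  rw [denom] at h
  rw [deriv_mul_denom, weight]
  push_cast
  rw [inv_inv]
  have hp : (pole k - 1) ^ 2 = - (height k : ℂ) ^ 2 := by
    rw [pole, add_sub_cancel_left, mul_pow, I_sq, mul_neg_one]
  linear_combination (2 + 2 * pole k) * h - 2 * hp

/-- The complement of the open rectangles `(-1, 2) × (π / 2 + (m - 1) π, π / 2 + m π)`. -/
def grid : Set ℂ := {w | 2 ≤ w.re ∨ w.re ≤ -1 ∨ ∃ m : ℤ, w.im = π / 2 + m * π}

lemma one_le_abs_pi_div_two_add (m : ℤ) : 1 ≤ |π / 2 + m * π| := by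
  rcases le_or_gt 0 m with hm | hm
  · have : (0 : ℝ) ≤ m := by exact_mod_cast hm
    exact le_abs.2 (.inl (by nlinarith [pi_gt_three]))
  · have : (m : ℝ) ≤ -1 := by exact_mod_cast Int.le_sub_one_of_lt hm
    exact le_abs.2 (.inr (by nlinarith [pi_gt_three]))

lemma one_le_norm_of_mem_grid {w : ℂ} (hw : w ∈ grid) : 1 ≤ ‖w‖ := by
  rcases hw with h | h | ⟨m, h⟩
  · exact le_trans (le_abs.2 (.inl (by linarith))) (abs_re_le_norm w)
  · exact le_trans (le_abs.2 (.inr (by linarith))) (abs_re_le_norm w)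
  · exact (h ▸ one_le_abs_pi_div_two_add m).trans (abs_im_le_norm w)

lemma half_norm_le_norm_denom {w : ℂ} (h : w.re ≤ -1) : ‖w‖ / 2 ≤ ‖denom w‖ := by
  have hsq := sq_norm_sub_two w
  have h1 : ‖w‖ ≤ ‖w - 2‖ := abs_le_of_sq_le_sq' (by linarith) (norm_nonneg _) |>.2
  have h2 : rexp (2 * (w.re - 1)) ≤ 1 / 2 := by
    have h4 : 2 ≤ rexp (-(2 * (w.re - 1))) := by
      linarith [Real.add_one_le_exp (-(2 * (w.re - 1)))]
    rw [Real.exp_neg] at h4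
    rw [one_div]
    exact (le_inv_comm₀ two_pos (Real.exp_pos _)).1 h4
  have h3 : ‖w - 2‖ - ‖w * cexp (2 * (w - 1))‖ ≤ ‖denom w‖ := norm_sub_norm_le _ _
  rw [norm_mul, norm_cexp_two_mul_sub_one] at h3
  have := mul_le_mul_of_nonneg_left h2 (norm_nonneg w)
  linarith

lemma one_half_le_norm_denom_of_mem_grid {w : ℂ} (hw : w ∈ grid) : 1 / 2 ≤ ‖denom w‖ := by
  have hw1 := one_le_norm_of_mem_grid hw
  have hsq := sq_norm_sub_two w
  have hexp : ‖w * cexp (2 * (w - 1))‖ = ‖w‖ * rexp (2 * (w.re - 1)) := by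
    rw [norm_mul, norm_cexp_two_mul_sub_one]
  rcases hw with h | h | ⟨m, h⟩
  · have h1 : ‖w - 2‖ ≤ ‖w‖ := abs_le_of_sq_le_sq' (by linarith) (norm_nonneg w) |>.2
    have h2 : 2 ≤ rexp (2 * (w.re - 1)) := by linarith [Real.add_one_le_exp (2 * (w.re - 1))]
    have h3 : ‖w * cexp (2 * (w - 1))‖ - ‖w - 2‖ ≤ ‖denom w‖ := by
      rw [denom, norm_sub_rev (w - 2)]
      exact norm_sub_norm_le _ _
    rw [hexp] at h3
    nlinarith
  · linarith [half_norm_le_norm_denom h]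
  · have hE : cexp (2 * (w - 1)) = ((-rexp (2 * (w.re - 1)) : ℝ) : ℂ) := by
      have hw : 2 * (w - 1) = ((2 * (w.re - 1) : ℝ) : ℂ) + π * I + m * (2 * π * I) := by
        apply Complex.ext
        · simp
        · simp [h]
          ring
      rw [hw, Complex.exp_add, Complex.exp_int_mul_two_pi_mul_I, Complex.exp_add,
        Complex.exp_pi_mul_I]
      push_cast
      ring
    have him : (denom w).im = w.im * (1 + rexp (2 * (w.re - 1))) := by
      rw [denom, hE, sub_im, sub_im, im_mul_ofReal]
      simp
      ring
    have h1 : 1 ≤ |w.im| := h ▸ one_le_abs_pi_div_two_add m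
    have h2 := abs_im_le_norm (denom w)
    rw [him, abs_mul, abs_of_pos (by positivity : 0 < 1 + rexp (2 * (w.re - 1)))] at h2
    nlinarith [Real.exp_pos (2 * (w.re - 1))]

lemma arctan_pi_div_four_le : Real.arctan (π / 4) ≤ π / 4 :=
  (Real.arctan_le_arctan_iff.2 (by linarith [pi_lt_four])).trans_eq Real.arctan_one

lemma arctan_pi_div_four_le_abs_arctan_height (k : ℤ) :
    Real.arctan (π / 4) ≤ |Real.arctan (height k)| := by
  have hlt := arctan_pi_div_four_le
  have hsum : π / 2 ≤ |height k + Real.arctan (height k)| := by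
    rw [height_add_arctan]
    rcases le_or_gt 0 k with hk | hk
    · have : (0 : ℝ) ≤ k := by exact_mod_cast hk
      exact le_abs.2 (.inl (by nlinarith [pi_pos]))
    · have : (k : ℝ) ≤ -1 := by exact_mod_cast Int.le_sub_one_of_lt hk
      exact le_abs.2 (.inr (by nlinarith [pi_pos]))
  by_contra! hcon
  obtain ⟨h1, h2⟩ := abs_lt.1 hcon
  rw [← Real.arctan_neg, Real.arctan_lt_arctan_iff] at h1
  rw [Real.arctan_lt_arctan_iff] at h2
  have h3 : |height k| < π / 4 := abs_lt.2 ⟨h1, h2⟩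
  linarith [abs_add_le (height k) (Real.arctan (height k))]

lemma arctan_pi_div_four_le_norm_sub_pole {w : ℂ} (hw : w ∈ grid) (k : ℤ) :
    Real.arctan (π / 4) ≤ ‖w - pole k‖ := by
  have hlt := arctan_pi_div_four_le
  have hre := abs_re_le_norm (w - pole k)
  have him := abs_im_le_norm (w - pole k)
  rw [sub_re, pole_re] at hre
  rw [sub_im, pole_im] at him
  rcases hw with h | h | ⟨m, h⟩
  · linarith [le_abs_self (w.re - 1), pi_lt_four]
  · linarith [neg_abs_le (w.re - 1), pi_lt_four]
  · refine le_trans ?_ him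
    have heq : w.im - height k = (m - k : ℤ) * π + Real.arctan (height k) := by
      push_cast
      linarith [height_add_arctan k]
    rw [heq]
    have h1 := neg_pi_div_two_lt_arctan (height k)
    have h2 := arctan_lt_pi_div_two (height k)
    rcases lt_trichotomy (m - k) 0 with hn | hn | hn
    · have : ((m - k : ℤ) : ℝ) ≤ -1 := by exact_mod_cast Int.le_sub_one_of_lt hn
      exact le_abs.2 (.inr (by nlinarith [pi_pos]))
    · simpa [hn] using arctan_pi_div_four_le_abs_arctan_height k
    · have : (1 : ℝ) ≤ ((m - k : ℤ) : ℝ) := by exact_mod_cast hn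
      exact le_abs.2 (.inl (by nlinarith [pi_pos]))

/-- An entire function bounded on `grid` is constant. -/
lemma apply_eq_apply_of_bounded_on_grid {h : ℂ → ℂ} (hd : Differentiable ℂ h) {C : ℝ}
    (hC : ∀ w ∈ grid, ‖h w‖ ≤ C) (z w : ℂ) : h z = h w := by
  refine hd.apply_eq_apply_of_bounded (isBounded_iff_forall_norm_le.2 ⟨C, ?_⟩) z w
  rintro _ ⟨w, rfl⟩
  by_cases hw : w ∈ grid
  · exact hC w hw
  simp only [grid, Set.mem_ofPred_eq, not_or, not_le] at hw
  obtain ⟨hw1, hw2, -⟩ := hw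
  set m : ℤ := ⌊(w.im - π / 2) / π⌋
  have hm1 : π / 2 + m * π ≤ w.im := by
    linarith [(le_div_iff₀ pi_pos).1 (Int.floor_le ((w.im - π / 2) / π))]
  have hm2 : w.im ≤ π / 2 + (m + 1 : ℤ) * π := by
    have := (div_lt_iff₀ pi_pos).1 (Int.lt_floor_add_one ((w.im - π / 2) / π))
    push_cast
    linarith
  have hlt : π / 2 + m * π < π / 2 + (m + 1 : ℤ) * π := by
    push_cast
    linarith [pi_pos]
  refine norm_le_of_forall_mem_frontier_norm_le
    (U := Set.Ioo (-1) 2 ×ℂ Set.Ioo (π / 2 + m * π) (π / 2 + (m + 1 : ℤ) * π))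
    ((Metric.isBounded_Ioo _ _).reProdIm (Metric.isBounded_Ioo _ _)) hd.diffContOnCl
    (fun z hz ↦ hC z ?_) ?_
  · rw [frontier_reProdIm, frontier_Ioo hlt, frontier_Ioo (by norm_num)] at hz
    rcases hz with ⟨-, hz | hz⟩ | ⟨hz | hz, -⟩
    · exact .inr (.inr ⟨_, hz⟩)
    · exact .inr (.inr ⟨_, hz⟩)
    · exact .inr (.inl (le_of_eq hz))
    · exact .inl (ge_of_eq hz)
  · rw [closure_reProdIm, closure_Ioo hlt.ne, closure_Ioo (by norm_num)]
    exact ⟨⟨hw2.le, hw1.le⟩, hm1, hm2⟩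

/-- The zeros of `w * denom w`. -/
noncomputable def singularity : ℤ ⊕ Unit → ℂ := Sum.elim pole fun _ ↦ 0

/-- The residues of `(w * denom w)⁻¹`. -/
noncomputable def residue : ℤ ⊕ Unit → ℂ := Sum.elim (fun k ↦ (weight k : ℂ)) fun _ ↦ -1 / 2

lemma singularity_injective : Function.Injective singularity :=
  pole_injective.sumElim (Function.injective_of_subsingleton _) fun k _ hk ↦ by
    simpa [pole_re] using congrArg re hk

lemma mul_denom_eq_zero_iff (w : ℂ) : w * denom w = 0 ↔ ∃ i, singularity i = w := by
  simp [singularity, denom_eq_zero_iff, or_comm, eq_comm]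

lemma summable_weight_div {w : ℂ} (hw : ∃ ε > 0, ∀ k, pole k ≠ w → ε ≤ ‖pole k - w‖) :
    Summable fun k ↦ (weight k : ℂ) / (w - pole k) := by
  refine summable_div_sub (summable_weight.congr fun k ↦ ?_) hw
  simp [abs_of_pos (weight_pos k)]

lemma weight_ne_zero (k : ℤ) : (weight k : ℂ) ≠ 0 := ofReal_ne_zero.2 (weight_pos k).ne'

lemma summable_norm_residue : Summable fun i ↦ ‖residue i‖ := by
  refine Summable.sum (fun i ↦ ‖residue i‖) (summable_weight.congr fun k ↦ ?_) (Summable.of_finite)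
  simp [residue, abs_of_pos (weight_pos k)]

lemma residue_ne_zero (i : ℤ ⊕ Unit) : residue i ≠ 0 := by
  rcases i with k | _
  · exact weight_ne_zero k
  · norm_num [residue]

lemma deriv_mul_denom_singularity (i : ℤ ⊕ Unit) :
    deriv (fun w ↦ w * denom w) (singularity i) = (residue i)⁻¹ := by
  rcases i with k | _
  · exact deriv_mul_denom_pole k
  · norm_num [singularity, residue, deriv_mul_denom]

lemma arctan_pi_div_four_le_norm_sub_singularity {w : ℂ} (hw : w ∈ grid) (i : ℤ ⊕ Unit) :
    Real.arctan (π / 4) ≤ ‖w - singularity i‖ := by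
  rcases i with k | _
  · exact arctan_pi_div_four_le_norm_sub_pole hw k
  · simp only [singularity, Sum.elim_inr, sub_zero]
    linarith [one_le_norm_of_mem_grid hw, arctan_pi_div_four_le, pi_lt_four]

lemma norm_inv_mul_denom_le {w : ℂ} (hw : w ∈ grid) : ‖(w * denom w)⁻¹‖ ≤ 2 * ‖w⁻¹‖ := by
  rw [mul_inv, norm_mul, mul_comm, norm_inv (denom w)]
  gcongr
  refine inv_le_of_inv_le₀ two_pos ?_
  linarith [one_half_le_norm_denom_of_mem_grid hw]

lemma exists_pole_gap (w : ℂ) : ∃ ε > 0, ∀ k, pole k ≠ w → ε ≤ ‖pole k - w‖ := by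
  refine exists_gap differentiable_mul_denom (fun k ↦ ?_) (fun z hz ↦ ?_) w
  · exact mul_eq_zero_of_right _ ((denom_eq_zero_iff _).2 ⟨k, rfl⟩)
  · rcases mul_eq_zero.1 hz with rfl | hz
    · simp [deriv_mul_denom]
    · obtain ⟨k, rfl⟩ := (denom_eq_zero_iff z).1 hz
      rw [deriv_mul_denom_pole]
      exact inv_ne_zero (weight_ne_zero k)

lemma mul_denom_ne_zero_of_mem_grid {w : ℂ} (hw : w ∈ grid) : w * denom w ≠ 0 := by
  have h1 := one_le_norm_of_mem_grid hw
  have h2 := one_half_le_norm_denom_of_mem_grid hw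
  exact mul_ne_zero (norm_pos_iff.1 (by linarith)) (norm_pos_iff.1 (by linarith))

/-- The point `-(n + 1)`; these points tend to infinity inside `grid`. -/
def negPoint (n : ℕ) : ℂ := -(n + 1)

lemma negPoint_mem_grid (n : ℕ) : negPoint n ∈ grid := .inr (.inl (by simp [negPoint]))

lemma norm_negPoint (n : ℕ) : ‖negPoint n‖ = n + 1 := by
  rw [negPoint, norm_neg]
  exact_mod_cast Complex.norm_natCast (n + 1)

lemma tendsto_norm_negPoint : Tendsto (fun n ↦ ‖negPoint n‖) atTop atTop := by
  simp_rw [norm_negPoint]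
  exact tendsto_atTop_add_const_right _ _ tendsto_natCast_atTop_atTop

lemma tendsto_inv_negPoint_sub (a : ℂ) :
    Tendsto (fun n ↦ (negPoint n - a)⁻¹) atTop (𝓝 0) := by
  refine tendsto_inv₀_cobounded.comp (tendsto_norm_atTop_iff_cobounded.1 ?_)
  refine tendsto_atTop_mono (fun n ↦ norm_sub_norm_le _ _) ?_
  exact tendsto_atTop_add_const_right _ (-‖a‖) tendsto_norm_negPoint

lemma norm_negPoint_le_norm_sub_pole (n : ℕ) (k : ℤ) : ‖negPoint n‖ ≤ ‖negPoint n - pole k‖ := by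
  have h2 := abs_re_le_norm (negPoint n - pole k)
  have h3 : (negPoint n - pole k).re = -(n + 2 : ℝ) := by
    simp [negPoint, pole_re]
    ring
  rw [h3, abs_neg, abs_of_pos (by positivity)] at h2
  linarith [norm_negPoint n]

lemma tendsto_tsum_residue :
    Tendsto (fun n ↦ ∑' i, residue i / (negPoint n - singularity i)) atTop (𝓝 0) := by
  have hδ : 0 < Real.arctan (π / 4) := Real.arctan_pos.2 (by positivity)
  rw [← tsum_zero (β := ℤ ⊕ Unit)]
  refine tendsto_tsum_of_dominated_convergence
    (summable_norm_residue.div_const (Real.arctan (π / 4)))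
    (fun i ↦ ?_) (.of_forall fun n i ↦ ?_)
  · simpa [div_eq_mul_inv] using
      (tendsto_inv_negPoint_sub (singularity i)).const_mul (residue i)
  · rw [norm_div]
    gcongr
    exact arctan_pi_div_four_le_norm_sub_singularity (negPoint_mem_grid n) i

lemma inv_mul_denom_eq_tsum_residue {w : ℂ} (hw : w * denom w ≠ 0) :
    (w * denom w)⁻¹ = ∑' i, residue i / (w - singularity i) := by
  obtain ⟨h, hd, hh⟩ := exists_entire_eq_inv_sub_tsum differentiable_mul_denom
    summable_norm_residue singularity_injective mul_denom_eq_zero_iff residue_ne_zero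
    deriv_mul_denom_singularity
  have hconst := apply_eq_apply_of_bounded_on_grid hd
    (C := 2 + (∑' i, ‖residue i‖) / Real.arctan (π / 4)) fun z hz ↦ by
      rw [hh z (mul_denom_ne_zero_of_mem_grid hz)]
      refine (norm_sub_le _ _).trans (add_le_add ?_ ?_)
      · refine (norm_inv_mul_denom_le hz).trans (mul_le_of_le_one_right two_pos.le ?_)
        rw [norm_inv]
        exact inv_le_one_of_one_le₀ (one_le_norm_of_mem_grid hz)
      · exact norm_tsum_div_sub_le summable_norm_residue
          (Real.arctan_pos.2 (by positivity)) (arctan_pi_div_four_le_norm_sub_singularity hz)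
  have hinv : Tendsto (fun n ↦ (negPoint n * denom (negPoint n))⁻¹) atTop (𝓝 0) :=
    squeeze_zero_norm (fun n ↦ norm_inv_mul_denom_le (negPoint_mem_grid n))
      (by simpa using (tendsto_inv_negPoint_sub 0).norm.const_mul 2)
  have hlim := (hinv.sub tendsto_tsum_residue).congr fun n ↦
    (hh _ (mul_denom_ne_zero_of_mem_grid (negPoint_mem_grid n))).symm.trans (hconst _ w)
  rw [sub_zero] at hlim
  exact sub_eq_zero.1 ((hh w hw).symm.trans (tendsto_nhds_unique tendsto_const_nhds hlim))

lemma inv_mul_denom_eq {w : ℂ} (hw : w * denom w ≠ 0) :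
    (w * denom w)⁻¹ = -1 / 2 / w + ∑' k, (weight k : ℂ) / (w - pole k) := by
  have hleft : HasSum ((fun i ↦ residue i / (w - singularity i)) ∘ Sum.inl)
      (∑' k, (weight k : ℂ) / (w - pole k)) := (summable_weight_div (exists_pole_gap w)).hasSum
  have hright : HasSum ((fun i ↦ residue i / (w - singularity i)) ∘ Sum.inr) (-1 / 2 / w) := by
    convert hasSum_unique (β := Unit) _ using 1
    simp [singularity, residue]
  rw [inv_mul_denom_eq_tsum_residue hw, (hleft.sum hright).tsum_eq, add_comm]

lemma tsum_weight : ∑' k, (weight k : ℂ) = 1 / 2 := by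
  have hlim : Tendsto (fun n ↦ ∑' k, negPoint n * ((weight k : ℂ) / (negPoint n - pole k))) atTop
      (𝓝 (∑' k, (weight k : ℂ))) := by
    refine tendsto_tsum_of_dominated_convergence (bound := weight) summable_weight (fun k ↦ ?_)
      (.of_forall fun n k ↦ ?_)
    · have := ((tendsto_inv_negPoint_sub (pole k)).const_mul (pole k)).const_add 1
        |>.const_mul (weight k : ℂ)
      simp only [mul_zero, add_zero, mul_one] at this
      refine this.congr fun n ↦ ?_
      have hne : negPoint n - pole k ≠ 0 := norm_pos_iff.1 <|
        (zero_lt_one.trans_le (one_le_norm_of_mem_grid (negPoint_mem_grid n))).trans_le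
          (norm_negPoint_le_norm_sub_pole n k)
      field_simp
      ring
    · rw [norm_mul, norm_div, norm_real, Real.norm_of_nonneg (weight_pos k).le]
      calc ‖negPoint n‖ * (weight k / ‖negPoint n - pole k‖)
          = weight k * (‖negPoint n‖ / ‖negPoint n - pole k‖) := by ring
        _ ≤ weight k := mul_le_of_le_one_right (weight_pos k).le
            (div_le_one_of_le₀ (norm_negPoint_le_norm_sub_pole n k) (norm_nonneg _))
  have hlim' : Tendsto (fun n ↦ (denom (negPoint n))⁻¹ + 1 / 2) atTop (𝓝 (0 + 1 / 2)) := by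
    refine Tendsto.add_const _ (squeeze_zero_norm (a := fun n ↦ 2 * ‖(negPoint n - 0)⁻¹‖)
      (fun n ↦ ?_) (by simpa using (tendsto_inv_negPoint_sub 0).norm.const_mul 2))
    have hn : 0 < ‖negPoint n‖ := by
      linarith [one_le_norm_of_mem_grid (negPoint_mem_grid n)]
    calc ‖(denom (negPoint n))⁻¹‖ ≤ (‖negPoint n‖ / 2)⁻¹ := by
          rw [norm_inv]
          exact inv_anti₀ (by positivity) (half_norm_le_norm_denom (by simp [negPoint]))
      _ = 2 * ‖(negPoint n - 0)⁻¹‖ := by rw [sub_zero, norm_inv, inv_div, div_eq_mul_inv]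
  have hEq : ∀ n, ∑' k, negPoint n * ((weight k : ℂ) / (negPoint n - pole k)) =
      (denom (negPoint n))⁻¹ + 1 / 2 := fun n ↦ by
    have hne := mul_denom_ne_zero_of_mem_grid (negPoint_mem_grid n)
    have h0 := left_ne_zero_of_mul hne
    have h1 := inv_mul_denom_eq hne
    rw [tsum_mul_left, ← sub_eq_iff_eq_add'.2 h1, mul_inv]
    field_simp
    ring
  simp_rw [hEq] at hlim
  simpa using tendsto_nhds_unique hlim hlim'

lemma hasSum_inv_denom {w : ℂ} (hw : denom w ≠ 0) :
    HasSum (fun k ↦ (weight k : ℂ) * pole k / (w - pole k)) (denom w)⁻¹ := by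
  have hne : ∀ k, w - pole k ≠ 0 := fun k hk ↦
    hw ((denom_eq_zero_iff w).2 ⟨k, (sub_eq_zero.1 hk).symm⟩)
  have h1 := (summable_weight_div (exists_pole_gap w)).hasSum.mul_left w
  have h2 : HasSum (fun k ↦ (weight k : ℂ)) (1 / 2) :=
    tsum_weight ▸ (summable_ofReal.2 summable_weight).hasSum
  have hterm : ∀ k, w * ((weight k : ℂ) / (w - pole k)) - weight k =
      weight k * pole k / (w - pole k) := fun k ↦ by
    have := hne k
    field_simp
    ring
  have hsum : w * ∑' k, (weight k : ℂ) / (w - pole k) - 1 / 2 = (denom w)⁻¹ := by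
    rcases eq_or_ne w 0 with rfl | hw0
    · norm_num [denom]
    · rw [← sub_eq_iff_eq_add'.2 (inv_mul_denom_eq (mul_ne_zero hw0 hw)), mul_inv]
      field_simp
      ring
  simpa only [hterm, hsum] using h1.sub h2

/-- Counterexample to Conjecture 3: there are v_k with Re v_k ≥ 1, |v_k| → ∞,
and d_k > 0 with ∑ d_k < ∞, such that F(w) = ∑_k d_k v_k/(w - v_k) is defined
(the series converges) at every w that is not a pole, and F has no zeros in ℂ. -/
theorem stmt_8 :
    ∃ (v : ℕ → ℂ) (d : ℕ → ℝ),
      (∀ k, 1 ≤ (v k).re) ∧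
      Tendsto (fun k => ‖v k‖) atTop atTop ∧
      (∀ k, 0 < d k) ∧ Summable d ∧
      ∀ w : ℂ, (∀ k, w ≠ v k) →
        Summable (fun k => (d k : ℂ) * v k / (w - v k)) ∧
        (∑' k, (d k : ℂ) * v k / (w - v k)) ≠ 0 := by
  let e : ℕ ≃ ℤ := Equiv.intEquivNat.symm
  refine ⟨pole ∘ e, weight ∘ e, fun k ↦ (pole_re _).ge, ?_, fun k ↦ weight_pos _,
    e.summable_iff.2 summable_weight, fun w hw ↦ ?_⟩
  · rw [← Nat.cofinite_eq_atTop]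
    exact tendsto_norm_pole.comp e.injective.tendsto_cofinite
  · have hne : denom w ≠ 0 := fun h ↦ by
      obtain ⟨k, rfl⟩ := (denom_eq_zero_iff w).1 h
      exact hw (e.symm k) (by simp)
    have h := e.hasSum_iff.2 (hasSum_inv_denom hne)
    exact ⟨h.summable, h.tsum_eq ▸ inv_ne_zero hne⟩
end

section
/- Let a_k > 0 with ∑ a_k < ∞ and w_k ∈ ℂ with |w_k| → ∞. Then m(r, F₁) = O(1) as r → ∞, where F₁(w) = ∑ a_k w_k/(w - w_k) and m denotes the Nevanlinna proximity function; in particular the Nevanlinna characteristic of F₁ is governed by its poles. -/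
open Complex Filter Real

open MeasureTheory Topology ComplexConjugate

theorem Complex.one_sub_ne_zero_of_norm_lt_one {u : ℂ} (hu : ‖u‖ < 1) : 1 - u ≠ 0 := by
  intro h
  rw [← sub_eq_zero.mp h] at hu
  simp at hu

theorem Complex.re_inv_one_sub_nonneg {u : ℂ} (hu : ‖u‖ < 1) : 0 ≤ ((1 - u)⁻¹).re := by
  rw [Complex.inv_re]
  refine div_nonneg ?_ (Complex.normSq_nonneg _)
  have := Complex.re_le_norm u
  simp only [Complex.sub_re, Complex.one_re]
  linarith

/-- A finite positive combination of the half-plane maps `z ↦ (1 - ζ z)⁻¹`, shifted by `1`. -/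
noncomputable def shiftedCauchySum (s : Finset ℕ) (a : ℕ → ℝ) (ζ : ℕ → ℂ) (z : ℂ) : ℂ :=
  1 + ∑ k ∈ s, (a k : ℂ) * (1 - ζ k * z)⁻¹

section shiftedCauchySum

variable {s : Finset ℕ} {a : ℕ → ℝ} {ζ : ℕ → ℂ} {z : ℂ}

theorem norm_mul_lt_one_of_le {u z : ℂ} (hu : ‖u‖ < 1) (hz : ‖z‖ ≤ 1) : ‖u * z‖ < 1 := by
  rw [norm_mul]
  nlinarith [norm_nonneg u, norm_nonneg z]

theorem one_le_re_shiftedCauchySum (ha : ∀ k, 0 ≤ a k) (hζ : ∀ k, ‖ζ k‖ < 1) (hz : ‖z‖ ≤ 1) :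
    1 ≤ (shiftedCauchySum s a ζ z).re := by
  have : 0 ≤ ∑ k ∈ s, ((a k : ℂ) * (1 - ζ k * z)⁻¹).re := by
    refine Finset.sum_nonneg fun k _ => ?_
    rw [Complex.re_ofReal_mul]
    exact mul_nonneg (ha k) (Complex.re_inv_one_sub_nonneg (norm_mul_lt_one_of_le (hζ k) hz))
  simpa [shiftedCauchySum, Complex.add_re, Complex.re_sum] using this

theorem posLog_norm_shiftedCauchySum_sub_one_le (ha : ∀ k, 0 ≤ a k) (hζ : ∀ k, ‖ζ k‖ < 1)
    (hz : ‖z‖ ≤ 1) :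
    log⁺ ‖shiftedCauchySum s a ζ z - 1‖ ≤ Real.log ‖shiftedCauchySum s a ζ z‖ := by
  have h := one_le_re_shiftedCauchySum (s := s) ha hζ hz
  have h1 : 1 ≤ ‖shiftedCauchySum s a ζ z‖ := h.trans (Complex.re_le_norm _)
  rw [← Real.posLog_eq_log (by rwa [abs_norm])]
  refine Real.posLog_le_posLog (norm_nonneg _) ?_
  rw [Complex.norm_def, Complex.norm_def]
  refine Real.sqrt_le_sqrt ?_
  simp only [Complex.normSq_apply, Complex.sub_re, Complex.one_re, Complex.sub_im, Complex.one_im]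
  nlinarith

theorem analyticAt_shiftedCauchySum (hζ : ∀ k, ‖ζ k‖ < 1) (hz : ‖z‖ ≤ 1) :
    AnalyticAt ℂ (shiftedCauchySum s a ζ) z := by
  unfold shiftedCauchySum
  refine analyticAt_const.add (Finset.analyticAt_fun_sum _ fun k _ => ?_)
  refine analyticAt_const.mul (AnalyticAt.inv (by fun_prop) ?_)
  exact Complex.one_sub_ne_zero_of_norm_lt_one (norm_mul_lt_one_of_le (hζ k) hz)

theorem shiftedCauchySum_ne_zero (ha : ∀ k, 0 ≤ a k) (hζ : ∀ k, ‖ζ k‖ < 1) (hz : ‖z‖ ≤ 1) :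
    shiftedCauchySum s a ζ z ≠ 0 := by
  intro h
  have := one_le_re_shiftedCauchySum (s := s) ha hζ hz
  rw [h, Complex.zero_re] at this
  linarith

theorem continuous_log_norm_shiftedCauchySum (ha : ∀ k, 0 ≤ a k) (hζ : ∀ k, ‖ζ k‖ < 1) :
    Continuous fun θ : ℝ => Real.log ‖shiftedCauchySum s a ζ (circleMap 0 1 θ)‖ := by
  have hz (θ : ℝ) : ‖circleMap 0 1 θ‖ ≤ 1 := by simp
  refine continuous_iff_continuousAt.mpr fun θ => ?_
  refine ContinuousAt.log (ContinuousAt.norm ?_)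
    (norm_ne_zero_iff.mpr (shiftedCauchySum_ne_zero ha hζ (hz θ)))
  exact ContinuousAt.comp (f := circleMap 0 1)
    (analyticAt_shiftedCauchySum hζ (hz θ)).continuousAt (continuous_circleMap 0 1).continuousAt

theorem integral_log_norm_shiftedCauchySum (ha : ∀ k, 0 ≤ a k) (hζ : ∀ k, ‖ζ k‖ < 1) :
    ∫ θ in (0 : ℝ)..2 * π, Real.log ‖shiftedCauchySum s a ζ (circleMap 0 1 θ)‖ =
      2 * π * Real.log (1 + ∑ k ∈ s, a k) := by
  have h : circleAverage (fun z => Real.log ‖shiftedCauchySum s a ζ z‖) 0 1 =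
      Real.log ‖shiftedCauchySum s a ζ 0‖ := by
    refine InnerProductSpace.HarmonicOnNhd.circleAverage_eq fun z hz => ?_
    have hz' : ‖z‖ ≤ 1 := by simpa using hz
    exact (analyticAt_shiftedCauchySum hζ hz').harmonicAt_log_norm
      (shiftedCauchySum_ne_zero ha hζ hz')
  have h0 : ‖shiftedCauchySum s a ζ 0‖ = 1 + ∑ k ∈ s, a k := by
    have : shiftedCauchySum s a ζ 0 = ((1 + ∑ k ∈ s, a k : ℝ) : ℂ) := by simp [shiftedCauchySum]
    rw [this, Complex.norm_real, Real.norm_of_nonneg]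
    have := Finset.sum_nonneg fun k (_ : k ∈ s) => ha k
    linarith
  rw [circleAverage_def, h0, smul_eq_mul] at h
  rw [← h]
  field_simp

end shiftedCauchySum

/-- The value on the circle `‖z‖ = 1` of `w / (z - w)`, as a function of `u = z / w` if `p` is
false and of `u = conj w * z` if `p` is true. -/
noncomputable def reflectedKernel (p : Prop) [Decidable p] (u : ℂ) : ℂ :=
  if p then conj (1 - u)⁻¹ - 1 else -(1 - u)⁻¹

theorem norm_reflectedKernel_le (p : Prop) [Decidable p] (u : ℂ) :
    ‖reflectedKernel p u‖ ≤ ‖(1 - u)⁻¹‖ + 1 := by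
  unfold reflectedKernel
  split_ifs
  · refine (norm_sub_le _ _).trans ?_
    rw [Complex.norm_conj, norm_one]
  · rw [norm_neg]
    linarith

theorem continuousAt_reflectedKernel (p : Prop) [Decidable p] {u : ℂ} (hu : 1 - u ≠ 0) :
    ContinuousAt (reflectedKernel p) u := by
  have : ContinuousAt (fun u : ℂ => (1 - u)⁻¹) u :=
    ContinuousAt.inv₀ (by fun_prop) hu
  unfold reflectedKernel
  split_ifs
  · exact (Complex.continuous_conj.continuousAt.comp this).sub continuousAt_const
  · exact this.neg

theorem posLog_norm_sum_reflectedKernel_le (s : Finset ℕ) (p : ℕ → Prop) [DecidablePred p]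
    {a : ℕ → ℝ} (ha : ∀ k, 0 ≤ a k) (hsum : Summable a) {ζ : ℕ → ℂ} (hζ : ∀ k, ‖ζ k‖ < 1)
    {z : ℂ} (hz : ‖z‖ ≤ 1) :
    log⁺ ‖∑ k ∈ s, (a k : ℂ) * reflectedKernel (p k) (ζ k * z)‖ ≤
      Real.log ‖shiftedCauchySum {k ∈ s | p k} a ζ z‖ +
      Real.log ‖shiftedCauchySum {k ∈ s | ¬ p k} a ζ z‖ +
      (log⁺ (∑' k, a k) + 2 * Real.log 2) := by
  have key : ∑ k ∈ s, (a k : ℂ) * reflectedKernel (p k) (ζ k * z) =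
      conj (shiftedCauchySum {k ∈ s | p k} a ζ z - 1) +
      (-(shiftedCauchySum {k ∈ s | ¬ p k} a ζ z - 1) + -((∑ k ∈ s with p k, a k : ℝ) : ℂ)) := by
    rw [← Finset.sum_filter_add_sum_filter_not s p]
    have h1 : ∑ k ∈ s with p k, (a k : ℂ) * reflectedKernel (p k) (ζ k * z) =
        ∑ k ∈ s with p k, ((a k : ℂ) * conj (1 - ζ k * z)⁻¹ - a k) := by
      refine Finset.sum_congr rfl fun k hk => ?_
      rw [reflectedKernel, if_pos (Finset.mem_filter.mp hk).2]
      ring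
    have h2 : ∑ k ∈ s with ¬ p k, (a k : ℂ) * reflectedKernel (p k) (ζ k * z) =
        ∑ k ∈ s with ¬ p k, -((a k : ℂ) * (1 - ζ k * z)⁻¹) := by
      refine Finset.sum_congr rfl fun k hk => ?_
      rw [reflectedKernel, if_neg (Finset.mem_filter.mp hk).2]
      ring
    rw [h1, h2, Finset.sum_sub_distrib, Finset.sum_neg_distrib]
    simp only [shiftedCauchySum, add_sub_cancel_left, map_sum, map_mul, Complex.conj_ofReal,
      Complex.ofReal_sum]
    ring
  rw [key]
  have hA := posLog_norm_shiftedCauchySum_sub_one_le (s := {k ∈ s | p k}) ha hζ hz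
  have hB := posLog_norm_shiftedCauchySum_sub_one_le (s := {k ∈ s | ¬ p k}) ha hζ hz
  have hC : log⁺ ‖-((∑ k ∈ s with p k, a k : ℝ) : ℂ)‖ ≤ log⁺ (∑' k, a k) := by
    have h0 := Finset.sum_nonneg fun k (_ : k ∈ s.filter p) => ha k
    rw [norm_neg, Complex.norm_real, Real.norm_of_nonneg h0]
    exact Real.posLog_le_posLog h0 (hsum.sum_le_tsum _ fun k _ => ha k)
  grw [Real.posLog_norm_add_le, Real.posLog_norm_add_le, Complex.norm_conj, norm_neg, hA, hB, hC]
  linarith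

theorem lintegral_posLog_norm_sum_reflectedKernel_le (s : Finset ℕ) (p : ℕ → Prop)
    [DecidablePred p] {a : ℕ → ℝ} (ha : ∀ k, 0 ≤ a k) (hsum : Summable a) {ζ : ℕ → ℂ}
    (hζ : ∀ k, ‖ζ k‖ < 1) :
    ∫⁻ θ in Set.Ioc 0 (2 * π), ENNReal.ofReal
      (log⁺ ‖∑ k ∈ s, (a k : ℂ) * reflectedKernel (p k) (ζ k * circleMap 0 1 θ)‖) ≤
    ENNReal.ofReal (2 * π * (2 * Real.log (1 + ∑' k, a k) +
      (log⁺ (∑' k, a k) + 2 * Real.log 2))) := by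
  have hz (θ : ℝ) : ‖circleMap 0 1 θ‖ ≤ 1 := by simp
  have hle (θ : ℝ) := posLog_norm_sum_reflectedKernel_le s p ha hsum hζ (hz θ)
  set c : ℝ := log⁺ (∑' k, a k) + 2 * Real.log 2
  have hcA := continuous_log_norm_shiftedCauchySum (s := {k ∈ s | p k}) ha hζ
  have hcB := continuous_log_norm_shiftedCauchySum (s := {k ∈ s | ¬ p k}) ha hζ
  have hlog (t : Finset ℕ) : Real.log (1 + ∑ k ∈ t, a k) ≤ Real.log (1 + ∑' k, a k) := by
    have h0 := Finset.sum_nonneg fun k (_ : k ∈ t) => ha k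
    refine Real.log_le_log (by linarith) ?_
    linarith [hsum.sum_le_tsum t fun k _ => ha k]
  refine (lintegral_mono fun θ => ENNReal.ofReal_le_ofReal (hle θ)).trans ?_
  rw [← ofReal_integral_eq_lintegral_ofReal]
  · refine ENNReal.ofReal_le_ofReal ?_
    rw [← intervalIntegral.integral_of_le (by positivity), intervalIntegral.integral_add,
      intervalIntegral.integral_add, integral_log_norm_shiftedCauchySum ha hζ,
      integral_log_norm_shiftedCauchySum ha hζ, intervalIntegral.integral_const, smul_eq_mul]
    · have hA := hlog {k ∈ s | p k}
      have hB := hlog {k ∈ s | ¬ p k}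
      rw [sub_zero, ← mul_add, ← mul_add]
      exact mul_le_mul_of_nonneg_left (by linarith) (by positivity)
    · exact hcA.intervalIntegrable _ _
    · exact hcB.intervalIntegrable _ _
    · exact (hcA.add hcB).intervalIntegrable _ _
    · exact intervalIntegrable_const
  · exact (((hcA.add hcB).add continuous_const).integrableOn_Icc).mono_set Set.Ioc_subset_Icc_self
  · exact Eventually.of_forall fun θ => Real.posLog_nonneg.trans (hle θ)

theorem countable_setOf_circleMap_eq (c : ℂ) : {θ : ℝ | circleMap 0 1 θ = c}.Countable := by
  rcases Set.eq_empty_or_nonempty {θ : ℝ | circleMap 0 1 θ = c} with h | ⟨θ₀, h₀⟩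
  · simp [h]
  · refine (Set.countable_range fun n : ℤ => θ₀ + n * (2 * π)).mono fun θ hθ => ?_
    have h : Complex.exp (θ * Complex.I) = Complex.exp (θ₀ * Complex.I) := by
      simpa [circleMap] using hθ.trans h₀.symm
    obtain ⟨n, hn⟩ := Complex.exp_eq_exp_iff_exists_int.mp h
    refine ⟨n, ?_⟩
    have := congrArg Complex.im hn
    simpa using this.symm

theorem ae_forall_one_sub_mul_circleMap_ne_zero (ζ : ℕ → ℂ) :
    ∀ᵐ θ : ℝ, ∀ k, 1 - ζ k * circleMap 0 1 θ ≠ 0 := by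
  refine ae_all_iff.mpr fun k => ?_
  refine (countable_setOf_circleMap_eq (ζ k)⁻¹).ae_notMem volume |>.mono fun θ hθ h => hθ ?_
  exact eq_inv_of_mul_eq_one_right (sub_eq_zero.mp h).symm

/-- Radial approach to the boundary costs at most a factor `2` in the Cauchy kernel. -/
theorem norm_inv_one_sub_mul_le {u : ℂ} (hu : ‖u‖ ≤ 1) (h1 : 1 - u ≠ 0) {t : ℝ} (ht0 : 0 ≤ t)
    (ht1 : t < 1) : ‖(1 - t * u)⁻¹‖ ≤ 2 * ‖(1 - u)⁻¹‖ := by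
  have hn : ‖(t : ℂ) * u‖ = t * ‖u‖ := by rw [norm_mul, Complex.norm_real, Real.norm_of_nonneg ht0]
  have ha : 1 - t ≤ ‖1 - t * u‖ := by
    have := norm_sub_norm_le (1 : ℂ) (t * u)
    rw [norm_one, hn] at this
    nlinarith
  have hb : ‖1 - u‖ ≤ ‖1 - t * u‖ + (1 - t) := by
    have h : (1 : ℂ) - u = (1 - t * u) - ((1 - t : ℝ) : ℂ) * u := by push_cast; ring
    rw [h]
    refine (norm_sub_le _ _).trans ?_
    rw [norm_mul, Complex.norm_real, Real.norm_of_nonneg (by linarith)]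
    nlinarith
  have hpos : 0 < ‖1 - u‖ := norm_pos_iff.mpr h1
  have hpos' : 0 < ‖1 - t * u‖ := by linarith
  rw [norm_inv, norm_inv, ← div_eq_mul_inv, inv_le_comm₀ hpos' (by positivity), inv_div]
  linarith

theorem summable_mul_norm_inv_one_sub {a : ℕ → ℝ} (ha : ∀ k, 0 ≤ a k) (hsum : Summable a)
    {u : ℕ → ℂ} (hu : Tendsto u atTop (𝓝 0)) : Summable fun k => a k * ‖(1 - u k)⁻¹‖ := by
  have h : Tendsto (fun k => ‖(1 - u k)⁻¹‖) atTop (𝓝 1) := by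
    have : Tendsto (fun k => ‖(1 - u k)⁻¹‖) atTop (𝓝 ‖((1 : ℂ) - 0)⁻¹‖) :=
      ((tendsto_const_nhds.sub hu).inv₀ (by simp)).norm
    simpa using this
  refine Summable.of_norm_bounded_eventually_nat (hsum.mul_right 2) ?_
  filter_upwards [h.eventually_le_const one_lt_two] with k hk
  rw [Real.norm_of_nonneg (mul_nonneg (ha k) (norm_nonneg _))]
  exact mul_le_mul_of_nonneg_left hk (ha k)

theorem tendsto_sum_reflectedKernel (p : ℕ → Prop) [DecidablePred p] {a : ℕ → ℝ}
    (ha : ∀ k, 0 ≤ a k) (hsum : Summable a) {u : ℕ → ℂ} (hu : Tendsto u atTop (𝓝 0))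
    (hu1 : ∀ k, ‖u k‖ ≤ 1) (hne : ∀ k, 1 - u k ≠ 0) {t : ℕ → ℝ} (ht0 : ∀ n, 0 ≤ t n)
    (ht1 : ∀ n, t n < 1) (ht : Tendsto t atTop (𝓝 1)) :
    Tendsto (fun n => ∑ k ∈ Finset.range n, (a k : ℂ) * reflectedKernel (p k) (t n * u k)) atTop
      (𝓝 (∑' k, (a k : ℂ) * reflectedKernel (p k) (u k))) := by
  have hlim := tendsto_tsum_of_dominated_convergence (𝓕 := atTop)
    (f := fun n k => if k ∈ Finset.range n then
      (a k : ℂ) * reflectedKernel (p k) (t n * u k) else 0)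
    (g := fun k => (a k : ℂ) * reflectedKernel (p k) (u k))
    (bound := fun k => 2 * (a k * ‖(1 - u k)⁻¹‖) + a k)
    (((summable_mul_norm_inv_one_sub ha hsum hu).mul_left 2).add hsum) ?_ ?_
  · refine hlim.congr fun n => ?_
    rw [tsum_eq_sum (s := Finset.range n) fun k hk => if_neg hk]
    exact Finset.sum_congr rfl fun k hk => if_pos hk
  · intro k
    have h1 : Tendsto (fun n => (t n : ℂ) * u k) atTop (𝓝 (u k)) := by
      simpa using ((Complex.continuous_ofReal.tendsto 1).comp ht).mul_const (u k)
    have h2 := ((continuousAt_reflectedKernel (p k) (hne k)).tendsto.comp h1).const_mul (a k : ℂ)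
    refine h2.congr' ?_
    filter_upwards [eventually_gt_atTop k] with n hn
    rw [if_pos (Finset.mem_range.mpr hn)]
    rfl
  · refine Eventually.of_forall fun n k => ?_
    have hb : 0 ≤ a k * ‖(1 - u k)⁻¹‖ := mul_nonneg (ha k) (norm_nonneg _)
    split_ifs
    · rw [norm_mul, Complex.norm_real, Real.norm_of_nonneg (ha k)]
      have h1 := norm_reflectedKernel_le (p k) (t n * u k)
      have h2 := norm_inv_one_sub_mul_le (hu1 k) (hne k) (ht0 n) (ht1 n)
      nlinarith [mul_le_mul_of_nonneg_left (h1.trans (add_le_add_left h2 1)) (ha k)]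
    · rw [norm_zero]
      linarith [ha k]

theorem integral_posLog_norm_tsum_reflectedKernel_le (p : ℕ → Prop) [DecidablePred p]
    {a : ℕ → ℝ} (ha : ∀ k, 0 ≤ a k) (hsum : Summable a) {ζ : ℕ → ℂ} (hζ : ∀ k, ‖ζ k‖ ≤ 1)
    (hζ0 : Tendsto ζ atTop (𝓝 0)) :
    ∫ θ in (0 : ℝ)..2 * π,
      log⁺ ‖∑' k, (a k : ℂ) * reflectedKernel (p k) (ζ k * circleMap 0 1 θ)‖ ≤
    2 * π * (2 * Real.log (1 + ∑' k, a k) + (log⁺ (∑' k, a k) + 2 * Real.log 2)) := by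
  set B := 2 * π * (2 * Real.log (1 + ∑' k, a k) + (log⁺ (∑' k, a k) + 2 * Real.log 2))
  have hB0 : 0 ≤ B := by
    have h1 : 0 ≤ Real.log (1 + ∑' k, a k) := Real.log_nonneg (by linarith [tsum_nonneg (L := .unconditional ℕ) ha])
    have h2 : 0 ≤ log⁺ (∑' k, a k) := Real.posLog_nonneg
    have h3 : 0 ≤ Real.log 2 := Real.log_nonneg one_le_two
    positivity
  set t : ℕ → ℝ := fun n => n / (n + 1) with ht_def
  have ht0 (n) : 0 ≤ t n := by positivity
  have ht1 (n) : t n < 1 := by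
    rw [ht_def, div_lt_one (by positivity)]
    linarith
  have ht : Tendsto t atTop (𝓝 1) := tendsto_natCast_div_add_atTop 1
  have htζ (n k) : ‖(t n : ℂ) * ζ k‖ < 1 := by
    rw [norm_mul, Complex.norm_real, Real.norm_of_nonneg (ht0 n)]
    nlinarith [hζ k, ht0 n, ht1 n, norm_nonneg (ζ k)]
  set f : ℕ → ℝ → ENNReal := fun n θ => ENNReal.ofReal (log⁺ ‖∑ k ∈ Finset.range n,
    (a k : ℂ) * reflectedKernel (p k) ((t n * ζ k) * circleMap 0 1 θ)‖) with hf
  have hcont (n) : Continuous (f n) := by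
    refine ENNReal.continuous_ofReal.comp (Real.continuous_posLog.comp (Continuous.norm ?_))
    refine continuous_finsetSum _ fun k _ => continuous_const.mul ?_
    refine continuous_iff_continuousAt.mpr fun θ => ?_
    refine ContinuousAt.comp (f := fun θ => (t n * ζ k) * circleMap 0 1 θ)
      (continuousAt_reflectedKernel _ (Complex.one_sub_ne_zero_of_norm_lt_one
        (norm_mul_lt_one_of_le (htζ n k) (by simp)))) ?_
    exact (continuous_const.mul (continuous_circleMap 0 1)).continuousAt
  have hlim : ∀ᵐ θ : ℝ, Tendsto (fun n => f n θ) atTop (𝓝 (ENNReal.ofReal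
      (log⁺ ‖∑' k, (a k : ℂ) * reflectedKernel (p k) (ζ k * circleMap 0 1 θ)‖))) := by
    filter_upwards [ae_forall_one_sub_mul_circleMap_ne_zero ζ] with θ hθ
    have h := tendsto_sum_reflectedKernel p ha hsum (u := fun k => ζ k * circleMap 0 1 θ)
      (by simpa using hζ0.mul_const (circleMap 0 1 θ)) (fun k => by simpa using hζ k) hθ
      ht0 ht1 ht
    have h' := ((ENNReal.continuous_ofReal.comp
      (Real.continuous_posLog.comp continuous_norm)).tendsto _).comp h
    simpa only [hf, mul_assoc, Function.comp_def] using h'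
  have hfatou : ∫⁻ θ in Set.Ioc 0 (2 * π), ENNReal.ofReal
      (log⁺ ‖∑' k, (a k : ℂ) * reflectedKernel (p k) (ζ k * circleMap 0 1 θ)‖) ≤
      ENNReal.ofReal B := by
    rw [lintegral_congr_ae ((ae_restrict_of_ae hlim).mono fun θ h => h.liminf_eq.symm)]
    refine (lintegral_liminf_le fun n => (hcont n).measurable).trans ?_
    exact liminf_le_of_le (by isBoundedDefault) fun b hb =>
      let ⟨n, hn⟩ := hb.exists
      hn.trans (lintegral_posLog_norm_sum_reflectedKernel_le _ p ha hsum (htζ n))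
  rw [intervalIntegral.integral_of_le (by positivity)]
  refine (ENNReal.ofReal_le_ofReal_iff hB0).mp (le_trans ?_ hfatou)
  refine (Real.ofReal_le_enorm _).trans ((enorm_integral_le_lintegral_enorm _).trans_eq ?_)
  exact lintegral_congr fun θ => Real.enorm_of_nonneg Real.posLog_nonneg

theorem div_sub_eq_reflectedKernel {r : ℝ} (hr : 0 < r) {z : ℂ} (hz : ‖z‖ = 1) {w : ℂ}
    (hne : 1 - (if ‖w‖ ≤ r then conj w / r else r / w) * z ≠ 0) :
    w / (r * z - w) = reflectedKernel (‖w‖ ≤ r)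
      ((if ‖w‖ ≤ r then conj w / r else r / w) * z) := by
  have hr' : (r : ℂ) ≠ 0 := by exact_mod_cast hr.ne'
  have hz0 : z ≠ 0 := by
    rintro rfl
    simp at hz
  have hzc : conj z = z⁻¹ := (Complex.inv_eq_conj hz).symm
  unfold reflectedKernel
  split_ifs at hne ⊢ with h
  · have hc : conj (1 - conj w / r * z) = (r * z - w) / (r * z) := by
      simp only [map_sub, map_one, map_mul, map_div₀, Complex.conj_conj, Complex.conj_ofReal, hzc]
      field_simp
    have hd : (r : ℂ) * z - w ≠ 0 := by
      intro h0
      rw [h0, zero_div] at hc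
      exact hne ((map_eq_zero _).mp hc)
    rw [map_inv₀, hc, inv_div, div_sub_one hd, sub_sub_cancel]
  · have hw : w ≠ 0 := by
      rintro rfl
      simp [hr.le] at h
    have hd : (r : ℂ) * z - w ≠ 0 := by
      intro h0
      apply h
      rw [← sub_eq_zero.mp h0, norm_mul, hz, Complex.norm_real, Real.norm_of_nonneg hr.le, mul_one]
    have : 1 - r / w * z = -(r * z - w) / w := by
      field_simp
      ring
    rw [this, inv_div, div_neg, neg_neg]

theorem tendsto_reflectedNode (r : ℝ) {w : ℕ → ℂ} (hw : Tendsto (fun k => ‖w k‖) atTop atTop) :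
    Tendsto (fun k => if ‖w k‖ ≤ r then conj (w k) / r else r / w k) atTop (𝓝 0) := by
  have h : Tendsto (fun k => (r : ℂ) / w k) atTop (𝓝 0) := by
    have := (Filter.tendsto_inv₀_cobounded.comp (tendsto_norm_atTop_iff_cobounded.mp hw)).const_mul
      (r : ℂ)
    simpa [Function.comp_def, div_eq_mul_inv] using this
  refine h.congr' ?_
  filter_upwards [hw.eventually_gt_atTop r] with k hk
  rw [if_neg hk.not_ge]

theorem norm_reflectedNode_le {r : ℝ} (hr : 0 < r) (w : ℂ) :
    ‖if ‖w‖ ≤ r then conj w / r else r / w‖ ≤ 1 := by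
  split_ifs with h
  · rw [norm_div, Complex.norm_conj, Complex.norm_real, Real.norm_of_nonneg hr.le]
    exact div_le_one_of_le₀ h hr.le
  · rw [norm_div, Complex.norm_real, Real.norm_of_nonneg hr.le]
    exact div_le_one_of_le₀ (not_le.mp h).le (norm_nonneg _)

/-- If a_k > 0, ∑ a_k < ∞ and |w_k| → ∞, then the Nevanlinna proximity function
m(r, F₁) = (1/2π)∫₀^{2π} log⁺|F₁(re^{iθ})| dθ of F₁(w) = ∑ a_k w_k/(w - w_k)
is O(1) as r → ∞. -/
theorem stmt_14
    (a : ℕ → ℝ) (w : ℕ → ℂ)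
    (hpos : ∀ k, 0 < a k) (hsum : Summable a)
    (hw : Tendsto (fun k => ‖w k‖) atTop atTop) :
    ∃ C : ℝ, ∀ᶠ r : ℝ in atTop,
      (2 * Real.pi)⁻¹ *
        (∫ θ in (0:ℝ)..(2 * Real.pi),
          Real.log (max 1 ‖∑' k, (a k : ℂ) * w k /
            ((r : ℂ) * Complex.exp (θ * Complex.I) - w k)‖)) ≤ C := by
  refine ⟨2 * Real.log (1 + ∑' k, a k) + (log⁺ (∑' k, a k) + 2 * Real.log 2), ?_⟩
  filter_upwards [eventually_gt_atTop 0] with r hr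
  set ζ : ℕ → ℂ := fun k => if ‖w k‖ ≤ r then conj (w k) / r else r / w k
  have hbound := integral_posLog_norm_tsum_reflectedKernel_le (fun k => ‖w k‖ ≤ r)
    (fun k => (hpos k).le) hsum (fun k => norm_reflectedNode_le hr (w k))
    (tendsto_reflectedNode r hw)
  rw [inv_mul_le_iff₀ (by positivity)]
  refine (intervalIntegral.integral_congr_ae ?_).trans_le hbound
  filter_upwards [ae_forall_one_sub_mul_circleMap_ne_zero ζ] with θ hθ _
  rw [← Real.posLog_eq_log_max_one (norm_nonneg _)]
  have hz : circleMap 0 1 θ = Complex.exp (θ * Complex.I) := by simp [circleMap]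
  rw [← hz]
  congr 3 with k
  rw [mul_div_assoc, div_sub_eq_reflectedKernel hr (by simp) (hθ k)]
end

section
/- Let D be a convex domain contained in {Re z < 1} with 1 ∈ ∂D, let z_k ∈ D and a_k > 0 with ∑ a_k < ∞, assume 1 is a limit point of {z_k}, and assume there are ε > 0 and λ ≥ 0 such that ∑_{|1 - z_k| ≤ ε} |1 - z_k|^τ < ∞ for all τ > λ, and sup{|arg(1 - z_k)| : |1 - z_k| ≤ ε} < π/(2λ). Then f(z) = ∑ a_k/(z - z_k) has a sequence of zeros η_j ∈ D with η_j → 1. -/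
open Complex Filter Real

open Metric in
/-- A **Harnack-type** lower bound for a zero-free bounded holomorphic function on a ball. -/
theorem pow_three_div_sq_le_norm_of_ne_zero {F : ℂ → ℂ} {c : ℂ} {R m M : ℝ} (hR : 0 < R)
    (hF : DifferentiableOn ℂ F (ball c R)) (hF0 : ∀ w ∈ ball c R, F w ≠ 0)
    (hM : ∀ w ∈ ball c R, ‖F w‖ ≤ M) (hm : 0 < m) (hc : m ≤ ‖F c‖)
    {w : ℂ} (hw : w ∈ ball c (R / 2)) : m ^ 3 / (4 * M ^ 2) ≤ ‖F w‖ := by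
  have hcm : c ∈ ball c R := mem_ball_self hR
  have hmM : ‖F c‖ ≤ M := hM c hcm
  have hMpos : 0 < M := hm.trans_le (hc.trans hmM)
  have hlog : DifferentiableOn ℂ (fun v => deriv F v / F v) (ball c R) :=
    (hF.deriv isOpen_ball).div hF hF0
  obtain ⟨h, hhc, hh⟩ := hlog.isExactOn_ball.with_val_at c 0
  have hconst : ∀ v ∈ ball c R, F v * Complex.exp (-h v) = F c := by
    intro v hv
    have hderiv : ∀ x ∈ ball c R,
        HasDerivAt (fun x => F x * Complex.exp (-h x)) 0 x := by
      intro x hx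
      have h1 := (hF.differentiableAt (isOpen_ball.mem_nhds hx)).hasDerivAt
      have h2 := h1.mul (hh x hx).neg.cexp
      have h3 := hF0 x hx
      refine h2.congr_deriv ?_
      field_simp
      ring
    have := (convex_ball c R).is_const_of_fderivWithin_eq_zero (𝕜 := ℂ)
      (f := fun x => F x * Complex.exp (-h x))
      (fun x hx => (hderiv x hx).differentiableAt.differentiableWithinAt)
      (fun x hx => by
        have := (hderiv x hx).hasFDerivAt.hasFDerivWithinAt (s := ball c R)
        rw [this.fderivWithin (isOpen_ball.uniqueDiffWithinAt hx)]
        ext; simp) hv hcm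
    simpa [hhc] using this
  have hnorm : ∀ v ∈ ball c R, ‖F v‖ = ‖F c‖ * Real.exp (h v).re := by
    intro v hv
    rw [← hconst v hv, norm_mul, Complex.norm_exp, mul_assoc, ← Real.exp_add]
    simp
  have hFc : 0 < ‖F c‖ := hm.trans_le hc
  set L := Real.log (2 * M / m) with hL
  have hLpos : 0 < L := Real.log_pos (by rw [lt_div_iff₀ hm]; linarith)
  have hre : ∀ v ∈ ball c R, (h v).re ≤ L := by
    intro v hv
    rw [hL, Real.le_log_iff_exp_le (by positivity), le_div_iff₀ hm]
    have := hM v hv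
    rw [hnorm v hv] at this
    nlinarith [Real.exp_pos (h v).re]
  have hsub : ∀ v ∈ ball (0 : ℂ) R, v + c ∈ ball c R := by
    intro v hv
    simpa [mem_ball, dist_eq_norm] using hv
  have hw' : ‖w - c‖ < R / 2 := by simpa [mem_ball, dist_eq_norm] using hw
  have key := Complex.borelCaratheodory_zero (f := fun v => h (v + c)) (M := L) (R := R)
    (z := w - c) hLpos
    (fun v hv => by
      have := (hh (v + c) (hsub v hv)).comp_add_const v c
      exact this.differentiableAt.differentiableWithinAt)
    (fun v hv => hre _ (hsub v hv)) hR (by simp; linarith) (by simp [hhc])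
  have hkey : ‖h w‖ ≤ 2 * L := by
    simp only [sub_add_cancel] at key
    refine key.trans ?_
    rw [div_le_iff₀ (by linarith)]
    nlinarith
  rw [hnorm w (ball_subset_ball (by linarith) hw)]
  have h1 : Real.exp (-(2 * L)) ≤ Real.exp (h w).re :=
    Real.exp_le_exp.2 (by linarith [neg_abs_le (h w).re, Complex.abs_re_le_norm (h w)])
  have h2 : Real.exp (-(2 * L)) = m ^ 2 / (4 * M ^ 2) := by
    rw [Real.exp_neg, two_mul, Real.exp_add, hL, Real.exp_log (by positivity)]
    field_simp
    norm_num
  calc m ^ 3 / (4 * M ^ 2) = m * Real.exp (-(2 * L)) := by rw [h2]; ring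
    _ ≤ ‖F c‖ * Real.exp (h w).re := by gcongr

/-- **Phragmén-Lindelöf principle** in a right half-strip, for functions of double exponential
growth. -/
theorem norm_le_of_half_strip {h : ℂ → ℂ} {t₀ s τ C B : ℝ} (hs : 0 < s) (hτ : 0 < τ)
    (hτs : τ * s < Real.pi / 2) (hB : 0 < B)
    (hd : ∀ ζ : ℂ, t₀ ≤ ζ.re → DifferentiableAt ℂ h ζ)
    (hside : ∀ ζ : ℂ, t₀ ≤ ζ.re → |ζ.im| = s → ‖h ζ‖ ≤ B)
    (hend : ∀ ζ : ℂ, ζ.re = t₀ → |ζ.im| ≤ s → ‖h ζ‖ ≤ B)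
    (hgrowth : ∀ ζ : ℂ, t₀ ≤ ζ.re → |ζ.im| ≤ s → ‖h ζ‖ ≤ Real.exp (C * Real.exp (τ * ζ.re)))
    {ζ : ℂ} (hζ : t₀ ≤ ζ.re) (hζs : |ζ.im| ≤ s) : ‖h ζ‖ ≤ B := by
  obtain ⟨κ, hτκ, hκ⟩ : ∃ κ, τ < κ ∧ κ < Real.pi / 2 / s :=
    exists_between (by rwa [lt_div_iff₀ hs])
  rw [lt_div_iff₀ hs] at hκ
  have hκpos : 0 < κ := hτ.trans hτκ
  have hcos : 0 < Real.cos (κ * s) :=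
    Real.cos_pos_of_mem_Ioo ⟨by nlinarith [Real.pi_pos], hκ⟩
  have hcosle : ∀ v : ℂ, |v.im| ≤ s → Real.cos (κ * s) ≤ Real.cos (κ * v.im) := by
    intro v hv
    rw [← Real.cos_abs (κ * v.im), abs_mul, abs_of_pos hκpos]
    apply Real.cos_le_cos_of_nonneg_of_le_pi (by positivity) (by linarith [Real.pi_pos])
    gcongr
  have hmul : ∀ δ : ℝ, ∀ v : ℂ, ‖Complex.exp (-(δ : ℂ) * Complex.exp (κ * v))‖ =
      Real.exp (-(δ * (Real.exp (κ * v.re) * Real.cos (κ * v.im)))) := by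
    intro δ v
    rw [Complex.norm_exp, ← Complex.ofReal_neg, Complex.re_ofReal_mul, Complex.exp_re]
    simp
  have hδ : ∀ δ : ℝ, 0 < δ →
      ‖h ζ‖ * Real.exp (-(δ * (Real.exp (κ * ζ.re) * Real.cos (κ * ζ.im)))) ≤ B := by
    intro δ hδ
    have hlim : Tendsto (fun T : ℝ => C * Real.exp (τ * T)
        - δ * Real.cos (κ * s) * Real.exp (κ * T)) atTop atBot := by
      have h1 : Tendsto (fun T : ℝ => Real.exp (κ * T)) atTop atTop :=
        Real.tendsto_exp_atTop.comp (tendsto_id.const_mul_atTop hκpos)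
      have h2 : Tendsto (fun T : ℝ => C * Real.exp (-((κ - τ) * T)) - δ * Real.cos (κ * s))
          atTop (nhds (C * 0 - δ * Real.cos (κ * s))) := by
        apply Tendsto.sub_const
        apply Tendsto.const_mul
        exact Real.tendsto_exp_neg_atTop_nhds_zero.comp
          (tendsto_id.const_mul_atTop (by linarith : 0 < κ - τ))
      refine (h1.atTop_mul_neg (by nlinarith [mul_pos hδ hcos]) h2).congr fun T => ?_
      have : Real.exp (τ * T) = Real.exp (κ * T) * Real.exp (-((κ - τ) * T)) := by
        rw [← Real.exp_add]; ring_nf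
      rw [this]; ring
    obtain ⟨T, hT1, hT2⟩ := ((hlim.eventually_le_atBot (Real.log B)).and
      (eventually_gt_atTop (max t₀ ζ.re))).exists
    have hT0 : t₀ < T := (le_max_left _ _).trans_lt hT2
    have hTζ : ζ.re < T := (le_max_right _ _).trans_lt hT2
    have hcl : closure (Set.Ioo t₀ T ×ℂ Set.Ioo (-s) s) = Set.Icc t₀ T ×ℂ Set.Icc (-s) s := by
      rw [closure_reProdIm, closure_Ioo hT0.ne, closure_Ioo (by linarith : -s ≠ s)]
    have hbd : Bornology.IsBounded (Set.Ioo t₀ T ×ℂ Set.Ioo (-s) s) :=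
      (Metric.isBounded_Ioo _ _).reProdIm (Metric.isBounded_Ioo _ _)
    have hfac : ∀ v : ℂ, |v.im| ≤ s → Real.exp (-(δ * (Real.exp (κ * v.re) *
        Real.cos (κ * v.im)))) ≤ Real.exp (-(δ * Real.cos (κ * s) * Real.exp (κ * v.re))) := by
      intro v hv
      apply Real.exp_le_exp.2
      have := mul_le_mul_of_nonneg_left (hcosle v hv)
        (mul_nonneg hδ.le (Real.exp_pos (κ * v.re)).le)
      linarith
    have hfac1 : ∀ v : ℂ, |v.im| ≤ s → Real.exp (-(δ * (Real.exp (κ * v.re) *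
        Real.cos (κ * v.im)))) ≤ 1 := by
      intro v hv
      refine (hfac v hv).trans (Real.exp_le_one_iff.2 ?_)
      have := mul_pos (mul_pos hδ hcos) (Real.exp_pos (κ * v.re))
      linarith
    have hmax := Complex.norm_le_of_forall_mem_frontier_norm_le hbd
      (f := fun v => h v * Complex.exp (-(δ : ℂ) * Complex.exp (κ * v))) (C := B) (z := ζ)
      (by
        apply DifferentiableOn.diffContOnCl
        rw [hcl]
        intro v hv
        have h1 := hd v hv.1.1
        exact (h1.mul (by fun_prop)).differentiableWithinAt)
      (by
        intro v hv
        rw [frontier_reProdIm, closure_Ioo hT0.ne, closure_Ioo (by linarith : -s ≠ s),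
          frontier_Ioo hT0, frontier_Ioo (by linarith)] at hv
        rw [norm_mul, hmul]
        rcases hv with ⟨hv1, hv2⟩ | ⟨hv1, hv2⟩
        · have him : |v.im| = s := by
            rcases hv2 with hv2 | hv2
            · rw [show v.im = -s from hv2, abs_neg, abs_of_pos hs]
            · rw [show v.im = s from hv2, abs_of_pos hs]
          exact (mul_le_mul (hside v hv1.1 him) (hfac1 v him.le) (Real.exp_pos _).le hB.le).trans
            (by simp)
        · have him : |v.im| ≤ s := abs_le.2 hv2
          rcases hv1 with hv1 | hv1
          · exact (mul_le_mul (hend v hv1 him) (hfac1 v him) (Real.exp_pos _).le hB.le).trans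
              (by simp)
          · have hvT : v.re = T := hv1
            refine (mul_le_mul (hgrowth v (hvT ▸ hT0.le) him) (hfac v him) (Real.exp_pos _).le
              (Real.exp_pos _).le).trans ?_
            rw [← Real.exp_add, hvT, ← Real.le_log_iff_exp_le hB]
            linarith)
      (by rw [hcl]; exact ⟨⟨hζ, hTζ.le⟩, abs_le.1 hζs⟩)
    rwa [norm_mul, hmul] at hmax
  have hlim : Tendsto (fun δ : ℝ =>
      ‖h ζ‖ * Real.exp (-(δ * (Real.exp (κ * ζ.re) * Real.cos (κ * ζ.im)))))
      (nhdsWithin 0 (Set.Ioi 0)) (nhds (‖h ζ‖ * Real.exp (-(0 * (Real.exp (κ * ζ.re) *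
        Real.cos (κ * ζ.im)))))) := by
    apply Tendsto.mono_left _ nhdsWithin_le_nhds
    apply Continuous.tendsto (by fun_prop : Continuous fun δ : ℝ =>
      ‖h ζ‖ * Real.exp (-(δ * (Real.exp (κ * ζ.re) * Real.cos (κ * ζ.im)))))
  have := le_of_tendsto hlim (eventually_nhdsWithin_of_forall fun δ hδ' => hδ δ hδ')
  simpa using this

/-- The sum `∑ a k / (d k - u)`. -/
noncomputable def cauchySum (a : ℕ → ℝ) (d : ℕ → ℂ) (u : ℂ) : ℂ := ∑' k, (a k : ℂ) / (d k - u)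

theorem re_div_ofReal_eq (c v : ℂ) (x : ℝ) :
    ((starRingEnd ℂ) c * ((x : ℂ) / v)).re = x * ((c * v).re / ‖v‖ ^ 2) := by
  rw [← Complex.normSq_eq_norm_sq, div_eq_mul_inv, Complex.inv_def]
  simp
  ring

theorem le_norm_cauchySum_of_re_nonpos {a : ℕ → ℝ} {d : ℕ → ℂ} (ha : ∀ k, 0 < a k)
    (hd : ∀ k, 0 < (d k).re) {u : ℂ} (hu : u.re ≤ 0) (hu1 : ‖u‖ ≤ 1)
    (hS : Summable fun k => (a k : ℂ) / (d k - u)) :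
    a 0 * ((d 0).re / (‖d 0‖ + 1) ^ 2) ≤ ‖cauchySum a d u‖ := by
  refine le_trans ?_ (Complex.re_le_norm _)
  rw [cauchySum, Complex.re_tsum hS]
  have hre : ∀ k, ((a k : ℂ) / (d k - u)).re = a k * ((d k - u).re / ‖d k - u‖ ^ 2) := by
    intro k
    simpa using re_div_ofReal_eq 1 (d k - u) (a k)
  have hpos : ∀ k, 0 < (d k - u).re := fun k => by
    rw [Complex.sub_re]; linarith [hd k]
  have hnonneg : ∀ k, 0 ≤ ((a k : ℂ) / (d k - u)).re := fun k => by
    rw [hre]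
    exact mul_nonneg (ha k).le (div_nonneg (hpos k).le (by positivity))
  refine le_trans ?_ ((Complex.hasSum_re hS.hasSum).summable.le_tsum 0 fun k _ => hnonneg k)
  rw [hre]
  have h0 : 0 < ‖d 0 - u‖ :=
    (hpos 0).trans_le (Complex.re_le_norm _)
  have h1 : ‖d 0 - u‖ ≤ ‖d 0‖ + 1 := (norm_sub_le _ _).trans (by linarith)
  have h2 : (d 0).re ≤ (d 0 - u).re := by rw [Complex.sub_re]; linarith
  have := ha 0
  have := (hd 0).le
  gcongr
  exact (hpos 0).le

theorem re_exp_mul_I_mul (ψ : ℝ) (v : ℂ) :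
    (Complex.exp (ψ * Complex.I) * v).re = ‖v‖ * Real.cos (ψ + Complex.arg v) := by
  conv_lhs => rw [← Complex.norm_mul_exp_arg_mul_I v, mul_left_comm, ← Complex.exp_add, ← add_mul,
    ← Complex.ofReal_add, Complex.re_ofReal_mul, Complex.exp_ofReal_mul_I_re]

/-- Two points in complementary sectors are separated, after a rotation, by a vertical line. -/
theorem exists_rotation_le_re_sub {s s' : ℝ} (hs : 0 ≤ s) (hss : s < s')
    (hs' : s' ≤ Real.pi / 2) :
    ∃ κ > 0, κ ≤ 1 ∧ ∀ u : ℂ, s' ≤ |Complex.arg u| → ∃ c : ℂ, ‖c‖ = 1 ∧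
      ∀ v : ℂ, |Complex.arg v| ≤ s → κ * (‖v‖ + ‖u‖) ≤ (c * (v - u)).re := by
  have hpi := Real.pi_pos
  set β := (Real.pi - (s' - s)) / 2 with hβ
  have hcos : ∀ x : ℝ, |x| ≤ β → Real.cos β ≤ Real.cos x := fun x hx => by
    rw [← Real.cos_abs x]
    exact Real.cos_le_cos_of_nonneg_of_le_pi (abs_nonneg _) (by linarith) hx
  refine ⟨Real.cos β, Real.cos_pos_of_mem_Ioo ⟨by linarith, by linarith⟩, Real.cos_le_one _,
    fun u hu => ?_⟩
  set φ := (s + s' - Real.pi) / 2 with hφ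
  have huπ := Complex.abs_arg_le_pi u
  obtain ⟨ψ, hψ, hψu⟩ : ∃ ψ, (ψ = -φ ∨ ψ = φ) ∧
      Real.cos β ≤ -Real.cos (ψ + Complex.arg u) := by
    rcases le_total 0 (Complex.arg u) with h | h
    · rw [abs_of_nonneg h] at hu huπ
      refine ⟨-φ, Or.inl rfl, ?_⟩
      rw [← Real.cos_sub_pi]
      exact hcos _ (abs_le.2 ⟨by linarith, by linarith⟩)
    · rw [abs_of_nonpos h] at hu huπ
      refine ⟨φ, Or.inr rfl, ?_⟩
      rw [← Real.cos_add_pi]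
      exact hcos _ (abs_le.2 ⟨by linarith, by linarith⟩)
  refine ⟨Complex.exp (ψ * Complex.I), Complex.norm_exp_ofReal_mul_I ψ, fun v hv => ?_⟩
  rw [mul_sub, Complex.sub_re, re_exp_mul_I_mul, re_exp_mul_I_mul]
  have hv' := abs_le.1 hv
  have h1 : Real.cos β ≤ Real.cos (ψ + Complex.arg v) := by
    apply hcos
    rcases hψ with rfl | rfl <;> exact abs_le.2 ⟨by linarith, by linarith⟩
  nlinarith [mul_le_mul_of_nonneg_left h1 (norm_nonneg v),
    mul_le_mul_of_nonneg_left hψu (norm_nonneg u)]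

theorem exists_le_norm_cauchySum_of_sector {a : ℕ → ℝ} {d : ℕ → ℂ} (ha : ∀ k, 0 < a k)
    (hsum : Summable a) (hd : ∀ k, 0 < (d k).re) {s s' ε : ℝ} (hε : 0 < ε) (hs : 0 ≤ s)
    (hss : s < s') (hs' : s' ≤ Real.pi / 2) (harg : ∀ k, ‖d k‖ ≤ ε → |Complex.arg (d k)| ≤ s)
    (hS : ∀ u, 0 < ‖u‖ → ‖u‖ < ε / 2 → (∀ k, u ≠ d k) →
      Summable fun k => (a k : ℂ) / (d k - u)) :
    ∃ m > 0, ∀ᶠ u in nhdsWithin 0 {u : ℂ | u ≠ 0 ∧ s' ≤ |Complex.arg u|},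
      m ≤ ‖cauchySum a d u‖ := by
  obtain ⟨κ, hκ, hκ1, hrot⟩ := exists_rotation_le_re_sub hs hss hs'
  have hd0 : ∀ k, 0 < ‖d k‖ := fun k => (hd k).trans_le (Complex.re_le_norm _)
  have hsmall : ∀ᶠ u in nhdsWithin (0 : ℂ) {u : ℂ | u ≠ 0 ∧ s' ≤ |Complex.arg u|},
      0 < ‖u‖ ∧ ‖u‖ < ε / 2 ∧ s' ≤ |Complex.arg u| := by
    filter_upwards [self_mem_nhdsWithin,
      nhdsWithin_le_nhds (Metric.ball_mem_nhds (0 : ℂ) (half_pos hε))] with u hu hu2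
    exact ⟨norm_pos_iff.2 hu.1, by simpa using hu2, hu.2⟩
  by_cases hsm : Summable fun k => a k / ‖d k‖
  · have hdist : ∀ u : ℂ, ‖u‖ < ε / 2 → s' ≤ |Complex.arg u| → ∀ k,
        κ / 2 * ‖d k‖ ≤ ‖d k - u‖ := by
      intro u hu1 hu2 k
      rcases le_or_gt ‖d k‖ ε with hk | hk
      · obtain ⟨c, hc, hcv⟩ := hrot u hu2
        have h1 := (hcv (d k) (harg k hk)).trans (Complex.re_le_norm _)
        rw [norm_mul, hc, one_mul] at h1
        nlinarith [norm_nonneg u, hd0 k]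
      · have := norm_sub_norm_le (d k) u
        nlinarith [hd0 k]
    have hbound : ∀ u : ℂ, ‖u‖ < ε / 2 → s' ≤ |Complex.arg u| → ∀ k,
        ‖(a k : ℂ) / (d k - u)‖ ≤ 2 / κ * (a k / ‖d k‖) := by
      intro u hu1 hu2 k
      rw [norm_div, Complex.norm_real, Real.norm_eq_abs, abs_of_pos (ha k)]
      have h1 := hdist u hu1 hu2 k
      have h2 := hd0 k
      have h3 := ha k
      calc a k / ‖d k - u‖ ≤ a k / (κ / 2 * ‖d k‖) := by gcongr
        _ = _ := by field_simp
    have ht : Tendsto (cauchySum a d) (nhdsWithin (0 : ℂ)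
        {u : ℂ | u ≠ 0 ∧ s' ≤ |Complex.arg u|}) (nhds (cauchySum a d 0)) := by
      refine tendsto_tsum_of_dominated_convergence (hsm.mul_left (2 / κ)) (fun k => ?_) ?_
      · have : d k - 0 ≠ 0 := by simpa using norm_pos_iff.1 (hd0 k)
        have hc : ContinuousAt (fun u : ℂ => (a k : ℂ) / (d k - u)) 0 :=
          ContinuousAt.div (by fun_prop) (by fun_prop) this
        exact hc.tendsto.mono_left nhdsWithin_le_nhds
      · filter_upwards [hsmall] with u hu k using hbound u hu.2.1 hu.2.2 k
    have hS0 : Summable fun k => (a k : ℂ) / (d k - 0) := by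
      refine Summable.of_norm_bounded hsm fun k => ?_
      rw [norm_div, Complex.norm_real, Real.norm_eq_abs, abs_of_pos (ha k), sub_zero]
    have h0 := le_norm_cauchySum_of_re_nonpos ha hd (u := 0) (by simp) (by simp) hS0
    have hpos : 0 < a 0 * ((d 0).re / (‖d 0‖ + 1) ^ 2) := by
      have := ha 0; have := hd 0; positivity
    refine ⟨_, half_pos (hpos.trans_le h0), ?_⟩
    exact (ht.norm.eventually_const_lt (half_lt_self (hpos.trans_le h0))).mono fun u hu => hu.le
  · set b : ℕ → ℝ := fun k => if ‖d k‖ ≤ ε then a k / ‖d k‖ else 0 with hb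
    have hbn : ∀ k, 0 ≤ b k := fun k => by
      have := ha k; simp only [hb]; split_ifs <;> positivity
    have hbs : ¬ Summable b := fun h => hsm <| by
      refine Summable.of_nonneg_of_le (fun k => by have := ha k; positivity) (fun k => ?_)
        (h.add (hsum.div_const ε))
      have h3 := ha k
      have h4 := hd0 k
      simp only [hb]
      split_ifs with hk
      · have : 0 ≤ a k / ε := by positivity
        linarith
      · rw [zero_add]
        have := (not_le.1 hk).le
        gcongr
    set A := ∑' k, a k with hA
    set M := (1 + 2 * A / ε) / κ with hM
    obtain ⟨T, hT⟩ : ∃ T : Finset ℕ, M < ∑ k ∈ T, b k := by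
      by_contra! hcon
      exact hbs (summable_of_sum_le hbn hcon)
    have htT : ∀ᶠ u in nhdsWithin (0 : ℂ) {u : ℂ | u ≠ 0 ∧ s' ≤ |Complex.arg u|},
        M < ∑ k ∈ T, if ‖d k‖ ≤ ε then a k / (‖d k‖ + ‖u‖) else 0 := by
      have hcont : ContinuousAt (fun u : ℂ => ∑ k ∈ T,
          if ‖d k‖ ≤ ε then a k / (‖d k‖ + ‖u‖) else 0) 0 := by
        apply tendsto_finsetSum
        intro k _
        split_ifs
        · have : ‖d k‖ + ‖(0 : ℂ)‖ ≠ 0 := by simpa using norm_pos_iff.1 (hd0 k)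
          exact (ContinuousAt.div (by fun_prop) (by fun_prop) this :
            ContinuousAt (fun u : ℂ => a k / (‖d k‖ + ‖u‖)) 0)
        · exact tendsto_const_nhds
      refine (hcont.tendsto.mono_left nhdsWithin_le_nhds).eventually_const_lt ?_
      simpa [hb] using hT
    refine ⟨1, one_pos, ?_⟩
    filter_upwards [hsmall, htT] with u hu huT
    obtain ⟨hu0, hu1, hu2⟩ := hu
    have hune : ∀ k, u ≠ d k := by
      rintro k rfl
      have := harg k (by linarith)
      linarith
    have hSu := hS u hu0 hu1 hune
    obtain ⟨c, hc, hcv⟩ := hrot u hu2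
    have hterm : ∀ k, κ * (if ‖d k‖ ≤ ε then a k / (‖d k‖ + ‖u‖) else 0) ≤
        ((starRingEnd ℂ) c * ((a k : ℂ) / (d k - u))).re + 2 / ε * a k := by
      intro k
      have hak := ha k
      have hdk := hd0 k
      split_ifs with hk
      · rw [re_div_ofReal_eq]
        have h1 := hcv (d k) (harg k hk)
        have h2 : 0 < ‖d k - u‖ := norm_pos_iff.2 (sub_ne_zero.2 (hune k).symm)
        have h3 : ‖d k - u‖ ≤ ‖d k‖ + ‖u‖ := norm_sub_le _ _
        have h4 : κ * (a k / (‖d k‖ + ‖u‖)) ≤ a k * ((c * (d k - u)).re / ‖d k - u‖ ^ 2) := by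
          calc κ * (a k / (‖d k‖ + ‖u‖))
              = a k * (κ * (‖d k‖ + ‖u‖) / (‖d k‖ + ‖u‖) ^ 2) := by field_simp
            _ ≤ _ := by gcongr; exact le_trans (by positivity) h1
        have h5 : 0 ≤ 2 / ε * a k := by positivity
        linarith
      · rw [mul_zero]
        have h1 := norm_sub_norm_le (d k) u
        have h2 : ‖(starRingEnd ℂ) c * ((a k : ℂ) / (d k - u))‖ ≤ 2 / ε * a k := by
          rw [norm_mul, RCLike.norm_conj, hc, one_mul, norm_div, Complex.norm_real,
            Real.norm_eq_abs, abs_of_pos hak]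
          calc a k / ‖d k - u‖ ≤ a k / (ε / 2) := by gcongr; linarith [not_le.1 hk]
            _ = _ := by field_simp
        have := neg_le_of_abs_le ((Complex.abs_re_le_norm _).trans h2)
        linarith
    have hSc : Summable fun k => ((starRingEnd ℂ) c * ((a k : ℂ) / (d k - u))).re :=
      (Complex.hasSum_re (hSu.mul_left _).hasSum).summable
    have hle : κ * M < ((starRingEnd ℂ) c * cauchySum a d u).re + 2 / ε * A := by
      calc κ * M < κ * ∑ k ∈ T, (if ‖d k‖ ≤ ε then a k / (‖d k‖ + ‖u‖) else 0) := by gcongr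
        _ ≤ ∑ k ∈ T, (((starRingEnd ℂ) c * ((a k : ℂ) / (d k - u))).re + 2 / ε * a k) := by
            rw [Finset.mul_sum]
            exact Finset.sum_le_sum fun k _ => hterm k
        _ ≤ ∑' k, (((starRingEnd ℂ) c * ((a k : ℂ) / (d k - u))).re + 2 / ε * a k) :=
            (hSc.add (hsum.mul_left _)).sum_le_tsum _ fun k _ => le_trans (by
              have := ha k; have := hd0 k
              split_ifs <;> positivity) (hterm k)
        _ = _ := by
            rw [hSc.tsum_add (hsum.mul_left _), ← Complex.re_tsum (hSu.mul_left _),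
              hSu.tsum_mul_left, hsum.tsum_mul_left, cauchySum]
    have hfin := Complex.re_le_norm ((starRingEnd ℂ) c * cauchySum a d u)
    rw [norm_mul, RCLike.norm_conj, hc, one_mul] at hfin
    have hκM : κ * M = 1 + 2 / ε * A := by rw [hM]; field_simp
    linarith

theorem exists_finset_annulus {d : ℕ → ℂ} {ε τ : ℝ} (hτ : 0 < τ)
    (hconv : Summable fun k => if ‖d k‖ ≤ ε then ‖d k‖ ^ τ else 0)
    {r R : ℝ} (hr : 0 < r) (hR : R ≤ ε) :
    ∃ K : Finset ℕ, (∀ k, k ∈ K ↔ r ≤ ‖d k‖ ∧ ‖d k‖ ≤ R) ∧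
      K.card * r ^ τ ≤ ∑' k, if ‖d k‖ ≤ ε then ‖d k‖ ^ τ else 0 := by
  have hle : ∀ k, r ≤ ‖d k‖ ∧ ‖d k‖ ≤ R → r ^ τ ≤ if ‖d k‖ ≤ ε then ‖d k‖ ^ τ else 0 := by
    rintro k ⟨h1, h2⟩
    rw [if_pos (h2.trans hR)]
    exact Real.rpow_le_rpow hr.le h1 hτ.le
  have hfin : {k | r ≤ ‖d k‖ ∧ ‖d k‖ ≤ R}.Finite := by
    have h1 := hconv.tendsto_cofinite_zero.eventually_lt_const (Real.rpow_pos_of_pos hr τ)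
    exact (Filter.eventually_cofinite.1 h1).subset fun k hk => not_lt.2 (hle k hk)
  refine ⟨hfin.toFinset, fun k => by simp, ?_⟩
  rw [← nsmul_eq_mul]
  refine (Finset.card_nsmul_le_sum _ _ _ fun k hk => hle k (by simpa using hk)).trans ?_
  exact hconv.sum_le_tsum _ fun k _ => by split_ifs <;> positivity

/-- On an annulus, `∑ a k / (d k - u)` is a quotient `F / P` of holomorphic functions, with explicit
bounds. -/
theorem exists_annulus_factorization {a : ℕ → ℝ} {d : ℕ → ℂ} (ha : ∀ k, 0 < a k)
    (hsum : Summable a) (hd : ∀ k, 0 < (d k).re) {r₁ r₂ : ℝ} (hr₁ : 0 < r₁) (hr : r₁ < r₂)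
    {K : Finset ℕ} (hK : ∀ k, k ∈ K ↔ r₁ / 2 ≤ ‖d k‖ ∧ ‖d k‖ ≤ 2 * r₂) :
    ∃ P F : ℂ → ℂ, Differentiable ℂ P ∧
      DifferentiableOn ℂ F {u | r₁ < ‖u‖ ∧ ‖u‖ < r₂} ∧
      (∀ u, r₁ < ‖u‖ → ‖u‖ < r₂ → ‖P u‖ ≤ (3 * r₂ / r₁) ^ K.card) ∧
      (∀ u, r₁ < ‖u‖ → ‖u‖ < r₂ →
        ‖F u‖ ≤ 3 * (∑' k, a k) * (3 * r₂ / r₁) ^ K.card / r₁) ∧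
      (∀ u, r₁ < ‖u‖ → ‖u‖ < r₂ → (∀ k, u ≠ d k) →
        (Summable fun k => (a k : ℂ) / (d k - u)) ∧ F u = cauchySum a d u * P u ∧ P u ≠ 0) ∧
      (∀ k, r₁ < ‖d k‖ → ‖d k‖ < r₂ → P (d k) = 0 ∧ F (d k) ≠ 0) ∧
      (∀ u : ℂ, u.re ≤ -r₁ → 1 ≤ ‖P u‖) := by
  classical
  have hr₂ : 0 < r₂ := hr₁.trans hr
  set U : Set ℂ := {u | r₁ < ‖u‖ ∧ ‖u‖ < r₂} with hU
  have hUo : IsOpen U := (isOpen_lt continuous_const continuous_norm).inter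
    (isOpen_lt continuous_norm continuous_const)
  set Z := K.image d with hZ
  set Q := 3 * r₂ / r₁ with hQ
  have hQ1 : 1 ≤ Q := by rw [hQ, le_div_iff₀ hr₁]; linarith
  set A := ∑' k, a k with hA
  set P : ℂ → ℂ := fun u => ∏ p ∈ Z, (p - u) / r₁ with hP
  set G : ℂ → ℂ := fun u => ∑ k ∈ K, (a k : ℂ) / r₁ * ∏ q ∈ Z.erase (d k), (q - u) / r₁ with hG
  set φ : ℕ → ℂ → ℂ := fun k u => if k ∈ K then 0 else (a k : ℂ) / (d k - u) with hφ
  set H : ℂ → ℂ := fun u => ∑' k, φ k u with hH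
  have hr₁c : (r₁ : ℂ) ≠ 0 := by exact_mod_cast hr₁.ne'
  have hfar : ∀ k, k ∉ K → ∀ u ∈ U, r₁ / 2 ≤ ‖d k - u‖ := by
    intro k hk u hu
    rw [hK, not_and_or, not_le, not_le] at hk
    rcases hk with hk | hk
    · have := norm_sub_norm_le u (d k)
      rw [norm_sub_rev] at this
      linarith [hu.1]
    · have := norm_sub_norm_le (d k) u
      linarith [hu.2]
  have hφle : ∀ k, ∀ u ∈ U, ‖φ k u‖ ≤ 2 / r₁ * a k := by
    intro k u hu
    have h3 := ha k
    simp only [hφ]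
    split_ifs with hk
    · rw [norm_zero]; positivity
    · rw [norm_div, Complex.norm_real, Real.norm_eq_abs, abs_of_pos h3]
      have := hfar k hk u hu
      calc a k / ‖d k - u‖ ≤ a k / (r₁ / 2) := by gcongr
        _ = _ := by field_simp
  have hφs : ∀ u ∈ U, Summable fun k => φ k u := fun u hu =>
    Summable.of_norm_bounded (hsum.mul_left _) fun k => hφle k u hu
  have hHd : DifferentiableOn ℂ H U := by
    refine Complex.differentiableOn_tsum_of_summable_norm (hsum.mul_left (2 / r₁))
      (fun k => ?_) hUo hφle
    simp only [hφ]
    split_ifs with hk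
    · exact differentiableOn_const _
    · refine (differentiableOn_const _).div (by fun_prop) fun u hu h0 => ?_
      have := hfar k hk u hu
      rw [h0, norm_zero] at this
      linarith
  have hHle : ∀ u ∈ U, ‖H u‖ ≤ 2 / r₁ * A := fun u hu =>
    tsum_of_norm_bounded (hsum.hasSum.mul_left _) fun k => hφle k u hu
  have hfac : ∀ u ∈ U, ∀ p ∈ Z, ‖(p - u) / r₁‖ ≤ Q := by
    intro u hu p hp
    obtain ⟨k, hk, rfl⟩ := Finset.mem_image.1 hp
    rw [norm_div, Complex.norm_real, Real.norm_eq_abs, abs_of_pos hr₁, hQ]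
    gcongr
    linarith [norm_sub_le (d k) u, ((hK k).1 hk).2, hu.2]
  have hprod : ∀ u ∈ U, ∀ W ⊆ Z, ‖∏ p ∈ W, (p - u) / r₁‖ ≤ Q ^ K.card := by
    intro u hu W hW
    rw [norm_prod]
    refine (Finset.prod_le_prod (fun _ _ => norm_nonneg _)
      fun p hp => hfac u hu p (hW hp)).trans ?_
    rw [Finset.prod_const]
    exact pow_le_pow_right₀ hQ1 ((Finset.card_le_card hW).trans Finset.card_image_le)
  have hPd : Differentiable ℂ P := by
    simp only [hP]; fun_prop
  have hGd : Differentiable ℂ G := by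
    simp only [hG]; fun_prop
  have hmemZ : ∀ k, d k ∈ U → k ∈ K := fun k hk =>
    (hK k).2 ⟨by linarith [hk.1], by linarith [hk.2]⟩
  refine ⟨P, fun u => G u + P u * H u, hPd,
    hGd.differentiableOn.add (hPd.differentiableOn.mul hHd),
    fun u h1 h2 => hprod u ⟨h1, h2⟩ Z subset_rfl, ?_, ?_, ?_, ?_⟩
  · intro u h1 h2
    have hu : u ∈ U := ⟨h1, h2⟩
    have hGle : ‖G u‖ ≤ A / r₁ * Q ^ K.card := by
      calc ‖G u‖ ≤ ∑ k ∈ K, a k * (Q ^ K.card / r₁) := by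
            refine norm_sum_le_of_le _ fun k _ => ?_
            have h3 := ha k
            rw [norm_mul, norm_div, Complex.norm_real, Complex.norm_real, Real.norm_eq_abs,
              Real.norm_eq_abs, abs_of_pos h3, abs_of_pos hr₁]
            calc a k / r₁ * ‖∏ q ∈ Z.erase (d k), (q - u) / r₁‖ ≤ a k / r₁ * Q ^ K.card := by
                  gcongr; exact hprod u hu _ (Finset.erase_subset _ _)
              _ = _ := by ring
        _ = (∑ k ∈ K, a k) * (Q ^ K.card / r₁) := by rw [Finset.sum_mul]
        _ ≤ A * (Q ^ K.card / r₁) := by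
            gcongr
            exact hsum.sum_le_tsum _ fun k _ => (ha k).le
        _ = _ := by ring
    have hPH : ‖P u * H u‖ ≤ Q ^ K.card * (2 / r₁ * A) := by
      rw [norm_mul]
      exact mul_le_mul (hprod u hu Z subset_rfl) (hHle u hu) (norm_nonneg _) (by positivity)
    refine (norm_add_le _ _).trans ((add_le_add hGle hPH).trans_eq ?_)
    ring
  · intro u h1 h2 hne
    have hu : u ∈ U := ⟨h1, h2⟩
    have hsub : ∀ k, d k - u ≠ 0 := fun k => sub_ne_zero.2 (hne k).symm
    set ψ : ℕ → ℂ := fun k => if k ∈ K then (a k : ℂ) / (d k - u) else 0 with hψ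
    have hψs : HasSum ψ (∑ k ∈ K, (a k : ℂ) / (d k - u)) := by
      have h3 : HasSum ψ (∑ k ∈ K, ψ k) := hasSum_sum_of_ne_finset_zero fun k hk => by
        simp only [hψ, if_neg hk]
      have h4 : ∑ k ∈ K, ψ k = ∑ k ∈ K, (a k : ℂ) / (d k - u) :=
        Finset.sum_congr rfl fun k hk => by simp only [hψ, if_pos hk]
      rwa [h4] at h3
    have htot : HasSum (fun k => (a k : ℂ) / (d k - u))
        (∑ k ∈ K, (a k : ℂ) / (d k - u) + H u) := by
      refine (hψs.add (hφs u hu).hasSum).congr_fun ?_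
      intro k
      simp only [hψ, hφ]
      split_ifs <;> simp
    refine ⟨htot.summable, ?_, ?_⟩
    · rw [cauchySum, htot.tsum_eq, add_mul, mul_comm (H u), Finset.sum_mul]
      change G u + P u * H u = _
      congr 1
      refine Finset.sum_congr rfl fun k hk => ?_
      rw [hP]
      simp only
      rw [← Finset.mul_prod_erase Z _ (Finset.mem_image_of_mem d hk)]
      have := hsub k
      field_simp
    · refine Finset.prod_ne_zero_iff.2 fun p hp => ?_
      obtain ⟨k, hk, rfl⟩ := Finset.mem_image.1 hp
      exact div_ne_zero (hsub k) hr₁c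
  · intro k h1 h2
    have hk := hmemZ k ⟨h1, h2⟩
    have hkZ : d k ∈ Z := Finset.mem_image_of_mem d hk
    have hP0 : P (d k) = 0 := Finset.prod_eq_zero hkZ (by simp)
    refine ⟨hP0, ?_⟩
    simp only [hP0, zero_mul, add_zero]
    have hGk : G (d k) = ((∑ j ∈ K with d j = d k, a j / r₁ : ℝ) : ℂ) *
        ∏ q ∈ Z.erase (d k), (q - d k) / r₁ := by
      simp only [hG]
      rw [Complex.ofReal_sum, Finset.sum_mul, Finset.sum_filter]
      refine Finset.sum_congr rfl fun j _ => ?_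
      split_ifs with hj
      · rw [hj]; push_cast; ring
      · rw [Finset.prod_eq_zero (Finset.mem_erase.2 ⟨fun h => hj h.symm, hkZ⟩) (by simp), mul_zero]
    rw [hGk]
    refine mul_ne_zero ?_ (Finset.prod_ne_zero_iff.2 fun q hq => ?_)
    · have : 0 < ∑ j ∈ K with d j = d k, a j / r₁ :=
        Finset.sum_pos (fun j _ => div_pos (ha j) hr₁) ⟨k, by simp [hk]⟩
      exact_mod_cast this.ne'
    · exact div_ne_zero (sub_ne_zero.2 (Finset.mem_erase.1 hq).1) hr₁c
  · intro u hu
    simp only [hP, norm_prod]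
    refine Finset.one_le_prod fun p hp => ?_
    obtain ⟨k, hk, rfl⟩ := Finset.mem_image.1 hp
    rw [norm_div, Complex.norm_real, Real.norm_eq_abs, abs_of_pos hr₁, one_le_div hr₁]
    refine le_trans ?_ (Complex.re_le_norm _)
    rw [Complex.sub_re]
    linarith [hd k]

theorem summable_div_sub_s19 {a : ℕ → ℝ} {d : ℕ → ℂ} (ha : ∀ k, 0 < a k)
    (hsum : Summable a) (hd : ∀ k, 0 < (d k).re) {ε τ : ℝ} (hτ : 0 < τ)
    (hconv : Summable fun k => if ‖d k‖ ≤ ε then ‖d k‖ ^ τ else 0)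
    {u : ℂ} (hu : 0 < ‖u‖) (huε : ‖u‖ < ε / 2) (hne : ∀ k, u ≠ d k) :
    Summable fun k => (a k : ℂ) / (d k - u) := by
  obtain ⟨K, hK, -⟩ := exists_finset_annulus hτ hconv (r := ‖u‖ / 2 / 2) (R := 2 * (ε / 2))
    (by positivity) (by linarith)
  obtain ⟨P, F, -, -, -, -, h, -⟩ := exists_annulus_factorization ha hsum hd
    (half_pos hu) (by linarith) hK
  exact (h u (by linarith) huε hne).1

open Classical in
/-- The reciprocal of `cauchySum a d`, set to `0` at the poles of `cauchySum a d`. -/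
noncomputable def cauchySumInv (a : ℕ → ℝ) (d : ℕ → ℂ) (u : ℂ) : ℂ :=
  if u ∈ Set.range d then 0 else (cauchySum a d u)⁻¹

theorem cauchySumInv_of_mem_range {a : ℕ → ℝ} {d : ℕ → ℂ} {u : ℂ} (hu : u ∈ Set.range d) :
    cauchySumInv a d u = 0 := if_pos hu

theorem cauchySumInv_of_forall_ne {a : ℕ → ℝ} {d : ℕ → ℂ} {u : ℂ} (hu : ∀ k, u ≠ d k) :
    cauchySumInv a d u = (cauchySum a d u)⁻¹ := if_neg fun ⟨k, hk⟩ => hu k hk.symm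

theorem exists_cauchySumInv_eq_div {a : ℕ → ℝ} {d : ℕ → ℂ} (ha : ∀ k, 0 < a k)
    (hsum : Summable a) (hd : ∀ k, 0 < (d k).re) {ε τ δ : ℝ} (hτ : 0 < τ)
    (hconv : Summable fun k => if ‖d k‖ ≤ ε then ‖d k‖ ^ τ else 0) (hδε : δ ≤ ε / 2)
    (hnz : ∀ u, 0 < ‖u‖ → ‖u‖ < δ → (∀ k, u ≠ d k) → cauchySum a d u ≠ 0)
    {r₁ r₂ : ℝ} (hr₁ : 0 < r₁) (hr : r₁ < r₂) (hr₂ : r₂ ≤ δ) :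
    ∃ n : ℕ, n * (r₁ / 2) ^ τ ≤ (∑' k, if ‖d k‖ ≤ ε then ‖d k‖ ^ τ else 0) ∧
      ∃ P F : ℂ → ℂ, Differentiable ℂ P ∧
      DifferentiableOn ℂ F {u | r₁ < ‖u‖ ∧ ‖u‖ < r₂} ∧
      (∀ u, r₁ < ‖u‖ → ‖u‖ < r₂ → F u ≠ 0 ∧ cauchySumInv a d u = P u / F u ∧
        ‖P u‖ ≤ (3 * r₂ / r₁) ^ n ∧ ‖F u‖ ≤ 3 * (∑' k, a k) * (3 * r₂ / r₁) ^ n / r₁) ∧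
      (∀ u, r₁ < ‖u‖ → ‖u‖ < r₂ → u.re ≤ -r₁ → ‖cauchySum a d u‖ ≤ ‖F u‖) := by
  obtain ⟨K, hK, hcard⟩ := exists_finset_annulus hτ hconv (r := r₁ / 2) (R := 2 * r₂)
    (by positivity) (by linarith)
  obtain ⟨P, F, hPd, hFd, hPle, hFle, hreg, hpole, hPge⟩ :=
    exists_annulus_factorization ha hsum hd hr₁ hr hK
  refine ⟨K.card, hcard, P, F, hPd, hFd, fun u h1 h2 => ?_, fun u h1 h2 hu => ?_⟩
  · have : F u ≠ 0 ∧ cauchySumInv a d u = P u / F u := by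
      by_cases hu : ∃ k, d k = u
      · obtain ⟨k, rfl⟩ := hu
        obtain ⟨h3, h4⟩ := hpole k h1 h2
        exact ⟨h4, by rw [cauchySumInv_of_mem_range ⟨k, rfl⟩, h3, zero_div]⟩
      · have hne : ∀ k, u ≠ d k := fun k h => hu ⟨k, h.symm⟩
        obtain ⟨-, h3, h4⟩ := hreg u h1 h2 hne
        have h5 := hnz u (hr₁.trans h1) (h2.trans_le hr₂) hne
        rw [h3, cauchySumInv_of_forall_ne hne]
        exact ⟨mul_ne_zero h5 h4, by field_simp⟩
    exact ⟨this.1, this.2, hPle u h1 h2, hFle u h1 h2⟩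
  · have hne : ∀ k, u ≠ d k := by
      rintro k rfl
      linarith [hd k]
    rw [(hreg u h1 h2 hne).2.1, norm_mul]
    exact le_mul_of_one_le_right (norm_nonneg _) (hPge u hu)

theorem differentiableAt_cauchySumInv {a : ℕ → ℝ} {d : ℕ → ℂ} (ha : ∀ k, 0 < a k)
    (hsum : Summable a) (hd : ∀ k, 0 < (d k).re) {ε τ δ : ℝ} (hτ : 0 < τ)
    (hconv : Summable fun k => if ‖d k‖ ≤ ε then ‖d k‖ ^ τ else 0) (hδε : δ ≤ ε / 2)
    (hnz : ∀ u, 0 < ‖u‖ → ‖u‖ < δ → (∀ k, u ≠ d k) → cauchySum a d u ≠ 0)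
    {u : ℂ} (hu : 0 < ‖u‖) (huδ : ‖u‖ < δ) : DifferentiableAt ℂ (cauchySumInv a d) u := by
  obtain ⟨n, -, P, F, hP, hF, hPF, -⟩ := exists_cauchySumInv_eq_div ha hsum hd hτ hconv hδε hnz
    (half_pos hu) (by linarith) le_rfl
  have hUo : IsOpen {v : ℂ | ‖u‖ / 2 < ‖v‖ ∧ ‖v‖ < δ} :=
    (isOpen_lt continuous_const continuous_norm).inter
      (isOpen_lt continuous_norm continuous_const)
  have hmem := hUo.mem_nhds ⟨half_lt_self hu, huδ⟩
  refine DifferentiableAt.congr_of_eventuallyEq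
    ((hP u).div (hF.differentiableAt hmem) (hPF u (half_lt_self hu) huδ).1) ?_
  filter_upwards [hmem] with v hv using (hPF v hv.1 hv.2).2.1

theorem exists_growth_cauchySumInv {a : ℕ → ℝ} {d : ℕ → ℂ} (ha : ∀ k, 0 < a k)
    (hsum : Summable a) (hd : ∀ k, 0 < (d k).re) {ε τ δ m : ℝ} (hτ : 0 < τ)
    (hconv : Summable fun k => if ‖d k‖ ≤ ε then ‖d k‖ ^ τ else 0) (hδε : δ ≤ ε / 2)
    (hnz : ∀ u, 0 < ‖u‖ → ‖u‖ < δ → (∀ k, u ≠ d k) → cauchySum a d u ≠ 0)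
    (hm : 0 < m) (hlow : ∀ r : ℝ, 0 < r → r < δ → m ≤ ‖cauchySum a d (-r)‖) :
    ∃ C : ℝ, ∀ ζ : ℂ, 0 ≤ ζ.re → Real.exp (-ζ.re + 10) ≤ δ → |ζ.im| ≤ Real.pi / 2 →
      ‖cauchySumInv a d (Complex.exp (-ζ))‖ ≤ Real.exp (C * Real.exp (τ * ζ.re)) := by
  set S := ∑' k, if ‖d k‖ ≤ ε then ‖d k‖ ^ τ else 0 with hS
  set A := ∑' k, a k with hA
  have hApos : 0 < A := hsum.tsum_pos (fun k => (ha k).le) 0 (ha 0)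
  set E := Real.log (36 * A ^ 2 * Real.exp 20 / m ^ 3) with hE
  have hS0 : 0 ≤ S := tsum_nonneg fun k => by split_ifs <;> positivity
  set N := S * (2 ^ τ * Real.exp (10 * τ)) with hN
  set Q : ℝ := 3 * Real.exp 20 with hQ
  have hQ1 : 1 ≤ Q := by
    have := Real.one_le_exp (show (0 : ℝ) ≤ 20 by norm_num)
    linarith
  refine ⟨3 * N * Real.log Q + 2 / τ + |E|, fun ζ hζ0 hζδ hζi => ?_⟩
  set t := ζ.re with ht
  set r₁ := Real.exp (-t - 10) with hr₁
  set r₂ := Real.exp (-t + 10) with hr₂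
  have hr₁pos : 0 < r₁ := Real.exp_pos _
  have hQr : 3 * r₂ / r₁ = Q := by
    rw [hQ, mul_div_assoc, hr₁, hr₂, ← Real.exp_sub]
    ring_nf
  obtain ⟨n, hn, P, F, hP, hF, hPF, hFlow⟩ := exists_cauchySumInv_eq_div ha hsum hd hτ hconv hδε
    hnz hr₁pos (Real.exp_lt_exp.2 (by linarith) : r₁ < r₂) hζδ
  rw [hQr] at hPF
  have hnN : n ≤ N * Real.exp (τ * t) := by
    have h1 : (r₁ / 2) ^ τ * (2 ^ τ * Real.exp (10 * τ) * Real.exp (τ * t)) = 1 := by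
      rw [Real.div_rpow hr₁pos.le (by norm_num), hr₁, ← Real.exp_mul]
      have h2 : (2 : ℝ) ^ τ ≠ 0 := (Real.rpow_pos_of_pos two_pos τ).ne'
      have h3 : Real.exp ((-t - 10) * τ) * (Real.exp (10 * τ) * Real.exp (τ * t)) = 1 := by
        rw [← Real.exp_add, ← Real.exp_add, Real.exp_eq_one_iff]
        ring
      rw [← h3]
      field_simp
    calc (n : ℝ) = n * (r₁ / 2) ^ τ * (2 ^ τ * Real.exp (10 * τ) * Real.exp (τ * t)) := by
          rw [mul_assoc, h1, mul_one]
      _ ≤ S * (2 ^ τ * Real.exp (10 * τ) * Real.exp (τ * t)) := by gcongr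
      _ = _ := by rw [hN]; ring
  set c : ℂ := t + Real.pi * Complex.I with hc
  have hball : ∀ w ∈ Metric.ball c 10, r₁ < ‖Complex.exp (-w)‖ ∧ ‖Complex.exp (-w)‖ < r₂ := by
    intro w hw
    rw [Metric.mem_ball, dist_eq_norm] at hw
    have h1 := (Complex.abs_re_le_norm (w - c)).trans_lt hw
    have h2 : (w - c).re = w.re - t := by simp [hc]
    rw [h2, abs_lt] at h1
    rw [Complex.norm_exp, Complex.neg_re]
    exact ⟨Real.exp_lt_exp.2 (by linarith), Real.exp_lt_exp.2 (by linarith)⟩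
  have hζc : ζ ∈ Metric.ball c (10 / 2) := by
    have h1 : ζ - c = (ζ.im - Real.pi : ℝ) * Complex.I := by
      apply Complex.ext <;> simp [hc, ht]
    rw [Metric.mem_ball, dist_eq_norm, h1, norm_mul, Complex.norm_real, Complex.norm_I, mul_one,
      Real.norm_eq_abs, abs_lt]
    have := abs_le.1 hζi
    constructor <;> linarith [Real.pi_lt_d2]
  have hexpc : Complex.exp (-c) = -(Real.exp (-t) : ℝ) := by
    rw [hc, neg_add, Complex.exp_add, Complex.exp_neg (Real.pi * Complex.I), Complex.exp_pi_mul_I]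
    push_cast
    norm_num
  have hc10 : c ∈ Metric.ball c 10 := Metric.mem_ball_self (by norm_num)
  have hmc : m ≤ ‖F (Complex.exp (-c))‖ := by
    obtain ⟨h1, h2⟩ := hball c hc10
    refine le_trans ?_ (hFlow _ h1 h2 ?_)
    · rw [hexpc]
      refine hlow _ (Real.exp_pos _) (lt_of_lt_of_le ?_ hζδ)
      exact Real.exp_lt_exp.2 (by linarith)
    · rw [hexpc, Complex.neg_re, Complex.ofReal_re]
      exact neg_le_neg (Real.exp_le_exp.2 (by linarith))
  have hmain := pow_three_div_sq_le_norm_of_ne_zero (F := fun w => F (Complex.exp (-w)))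
    (c := c) (R := 10) (M := 3 * A * Q ^ n / r₁) (by norm_num)
    (hF.comp (by fun_prop) fun w hw => hball w hw)
    (fun w hw => (hPF _ (hball w hw).1 (hball w hw).2).1)
    (fun w hw => (hPF _ (hball w hw).1 (hball w hw).2).2.2.2) hm hmc hζc
  obtain ⟨hζ1, hζ2⟩ := hball ζ (Metric.ball_subset_ball (by norm_num) hζc)
  obtain ⟨-, hinv, hPle, -⟩ := hPF _ hζ1 hζ2
  rw [hinv, norm_div]
  have hQpos : 0 < Q := by linarith
  have hpos : 0 < m ^ 3 / (4 * (3 * A * Q ^ n / r₁) ^ 2) := by positivity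
  calc ‖P (Complex.exp (-ζ))‖ / ‖F (Complex.exp (-ζ))‖
      ≤ Q ^ n / (m ^ 3 / (4 * (3 * A * Q ^ n / r₁) ^ 2)) := by gcongr
    _ = Q ^ (3 * n) * (36 * A ^ 2 * Real.exp 20 / m ^ 3) * Real.exp (2 * t) := by
        have h1 : Real.exp 20 * Real.exp (2 * t) * r₁ ^ 2 = 1 := by
          rw [hr₁, ← Real.exp_nat_mul, ← Real.exp_add, ← Real.exp_add, Real.exp_eq_one_iff]
          push_cast; ring
        clear_value Q
        field_simp
        linear_combination (-36) * Q ^ (3 * n) * h1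
    _ = Real.exp (3 * n * Real.log Q + E + 2 * t) := by
        rw [Real.exp_add, Real.exp_add, hE, Real.exp_log (by positivity), ← Real.rpow_natCast,
          Real.rpow_def_of_pos hQpos]
        push_cast
        ring_nf
    _ ≤ Real.exp ((3 * N * Real.log Q + 2 / τ + |E|) * Real.exp (τ * t)) := by
        apply Real.exp_le_exp.2
        have h1 : 1 ≤ Real.exp (τ * t) := Real.one_le_exp (by positivity)
        have h2 : 2 * t ≤ 2 / τ * Real.exp (τ * t) := by
          have := Real.add_one_le_exp (τ * t)
          rw [div_mul_eq_mul_div, le_div_iff₀ hτ]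
          linarith
        have h3 : E ≤ |E| * Real.exp (τ * t) :=
          (le_abs_self E).trans (le_mul_of_one_le_right (abs_nonneg E) h1)
        have h4 : 3 * n * Real.log Q ≤ 3 * (N * Real.exp (τ * t)) * Real.log Q := by
          have := Real.log_nonneg hQ1
          gcongr
        linarith

theorem exists_cauchySum_eq_zero {a : ℕ → ℝ} {d : ℕ → ℂ} (ha : ∀ k, 0 < a k)
    (hsum : Summable a) (hd : ∀ k, 0 < (d k).re) {ε τ s m δ : ℝ} (hτ : 0 < τ)
    (hconv : Summable fun k => if ‖d k‖ ≤ ε then ‖d k‖ ^ τ else 0)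
    (hlim : (0 : ℂ) ∈ closure (Set.range d)) (hδ : 0 < δ) (hδε : δ ≤ ε / 2)
    (hs : 0 < s) (hsπ : s ≤ Real.pi / 2) (hτs : τ * s < Real.pi / 2) (hm : 0 < m)
    (hoff : ∀ u, 0 < ‖u‖ → ‖u‖ < δ → s ≤ |Complex.arg u| → (∀ k, u ≠ d k) →
      m ≤ ‖cauchySum a d u‖) :
    ∃ u, 0 < ‖u‖ ∧ ‖u‖ < δ ∧ (∀ k, u ≠ d k) ∧ cauchySum a d u = 0 := by
  by_contra! hnz
  have hpi := Real.pi_pos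
  have hneg : ∀ r : ℝ, 0 < r → ∀ k, -(r : ℂ) ≠ d k := by
    intro r hr k h
    have := hd k
    rw [← h, Complex.neg_re, Complex.ofReal_re] at this
    linarith
  obtain ⟨C, hC⟩ := exists_growth_cauchySumInv ha hsum hd hτ hconv hδε hnz hm
    (fun r hr hrδ => by
      refine hoff _ (by simpa using hr.ne') (by simpa [abs_of_pos hr] using hrδ) ?_ (hneg r hr)
      rw [← Complex.ofReal_neg, Complex.arg_ofReal_of_neg (by linarith), abs_of_pos hpi]
      linarith)
  have hdiff := fun u => differentiableAt_cauchySumInv ha hsum hd hτ hconv hδε hnz (u := u)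
  have hoff' : ∀ u, 0 < ‖u‖ → ‖u‖ < δ → s ≤ |Complex.arg u| → ‖cauchySumInv a d u‖ ≤ 1 / m := by
    intro u h1 h2 h3
    by_cases hu : ∃ k, d k = u
    · rw [cauchySumInv_of_mem_range hu, norm_zero]; positivity
    · have hne : ∀ k, u ≠ d k := fun k h => hu ⟨k, h.symm⟩
      rw [cauchySumInv_of_forall_ne hne, norm_inv, ← one_div]
      have := hoff u h1 h2 h3 hne
      gcongr
  set t₀ := max 0 (10 - Real.log δ) with ht₀
  have hexp10 : ∀ t, t₀ ≤ t → Real.exp (-t + 10) ≤ δ := by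
    intro t ht
    rw [← Real.le_log_iff_exp_le hδ]
    linarith [le_max_right 0 (10 - Real.log δ)]
  have hexp : ∀ ζ : ℂ, t₀ ≤ ζ.re → 0 < ‖Complex.exp (-ζ)‖ ∧ ‖Complex.exp (-ζ)‖ < δ := by
    intro ζ hζ
    rw [Complex.norm_exp, Complex.neg_re]
    exact ⟨Real.exp_pos _, (Real.exp_lt_exp.2 (by linarith)).trans_le (hexp10 _ hζ)⟩
  have hcomp : ∀ ζ : ℂ, t₀ ≤ ζ.re →
      DifferentiableAt ℂ (fun ζ => cauchySumInv a d (Complex.exp (-ζ))) ζ := fun ζ hζ =>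
    DifferentiableAt.comp ζ (hdiff _ (hexp ζ hζ).1 (hexp ζ hζ).2) (by fun_prop)
  obtain ⟨B₀, hB₀⟩ : ∃ B₀, ∀ ζ ∈ Set.Icc t₀ t₀ ×ℂ Set.Icc (-s) s,
      ‖cauchySumInv a d (Complex.exp (-ζ))‖ ≤ B₀ :=
    (isCompact_Icc.reProdIm isCompact_Icc).exists_bound_of_continuousOn
      fun ζ hζ => (hcomp ζ hζ.1.1).continuousAt.continuousWithinAt
  set B := max (1 / m) B₀ with hB
  have hstrip : ∀ ζ : ℂ, t₀ ≤ ζ.re → |ζ.im| ≤ s → ‖cauchySumInv a d (Complex.exp (-ζ))‖ ≤ B := by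
    intro ζ hζ1 hζ2
    refine norm_le_of_half_strip (h := fun ζ => cauchySumInv a d (Complex.exp (-ζ))) (C := C)
      hs hτ hτs (lt_max_of_lt_left (by positivity)) hcomp ?_ ?_ ?_ hζ1 hζ2
    · intro w hw1 hw2
      refine (hoff' _ (hexp w hw1).1 (hexp w hw1).2 ?_).trans (le_max_left _ _)
      have hw3 := abs_le.1 hw2.le
      rw [← Complex.log_im, Complex.log_exp (by rw [Complex.neg_im]; linarith)
        (by rw [Complex.neg_im]; linarith), Complex.neg_im, abs_neg, hw2]
    · intro w hw1 hw2
      exact (hB₀ w ⟨⟨hw1.ge, hw1.le⟩, abs_le.1 hw2⟩).trans (le_max_right _ _)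
    · intro w hw1 hw2
      exact hC w ((le_max_left _ _).trans hw1) (hexp10 _ hw1) (hw2.trans hsπ)
  set r := Real.exp (-t₀) with hr
  have hrpos : 0 < r := Real.exp_pos _
  have hrδ : r < δ := (Real.exp_lt_exp.2 (by linarith)).trans_le (hexp10 t₀ le_rfl)
  have hbdd : ∀ u, 0 < ‖u‖ → ‖u‖ < r → ‖cauchySumInv a d u‖ ≤ B := by
    intro u h1 h2
    rcases le_total s |Complex.arg u| with h3 | h3
    · exact (hoff' u h1 (h2.trans hrδ) h3).trans (le_max_left _ _)
    · have h4 := hstrip (-Complex.log u) (by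
        rw [Complex.neg_re, Complex.log_re]
        have := (Real.log_lt_log h1 h2).le
        rw [hr, Real.log_exp] at this
        linarith) (by rwa [Complex.neg_im, abs_neg, Complex.log_im])
      rwa [neg_neg, Complex.exp_log (norm_pos_iff.1 h1)] at h4
  have hball := Metric.ball_mem_nhds (0 : ℂ) hrpos
  have hmemball : ∀ u ∈ Metric.ball (0 : ℂ) r \ {0}, 0 < ‖u‖ ∧ ‖u‖ < r := fun u hu =>
    ⟨norm_pos_iff.2 hu.2, by simpa using hu.1⟩
  have han := (Complex.differentiableOn_update_limUnder_of_bddAbove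
    (f := cauchySumInv a d) hball
    (fun u hu => (hdiff u (hmemball u hu).1
      ((hmemball u hu).2.trans hrδ)).differentiableWithinAt)
    ⟨B, by rintro _ ⟨u, hu, rfl⟩; exact hbdd u (hmemball u hu).1 (hmemball u hu).2⟩).analyticAt hball
  rcases han.eventually_eq_zero_or_eventually_ne_zero with h0 | h0
  · obtain ⟨ρ, hρ, hρ0⟩ := Metric.eventually_nhds_iff.1 h0
    set x := min ρ δ / 2 with hx
    have hxpos : 0 < x := half_pos (lt_min hρ hδ)
    have hxρ : x < ρ := (half_lt_self (lt_min hρ hδ)).trans_le (min_le_left _ _)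
    have hxδ : x < δ := (half_lt_self (lt_min hρ hδ)).trans_le (min_le_right _ _)
    have hnx : ‖-(x : ℂ)‖ = x := by
      rw [norm_neg, Complex.norm_real, Real.norm_eq_abs, abs_of_pos hxpos]
    have h1 := hρ0 (y := -(x : ℂ)) (by rw [dist_zero_right, hnx]; exact hxρ)
    rw [Function.update_of_ne (by simpa using hxpos.ne'),
      cauchySumInv_of_forall_ne (hneg x hxpos)] at h1
    exact hnz _ (by rwa [hnx]) (by rwa [hnx]) (hneg x hxpos) (inv_eq_zero.1 h1)
  · rw [eventually_nhdsWithin_iff] at h0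
    obtain ⟨_, hu, k, rfl⟩ := (mem_closure_iff_frequently.1 hlim).and_eventually h0 |>.exists.imp
      fun _ h => And.symm h
    have hk : d k ≠ 0 := fun h => by
      have := hd k
      simp [h] at this
    apply hu hk
    rw [Function.update_of_ne hk, cauchySumInv_of_mem_range ⟨k, rfl⟩]

theorem exists_sector_bound {a : ℕ → ℝ} {d : ℕ → ℂ} (ha : ∀ k, 0 < a k)
    (hsum : Summable a) (hd : ∀ k, 0 < (d k).re) {ε lam : ℝ} (hε : 0 < ε) (hlam : 0 ≤ lam)
    (hconv : ∀ τ : ℝ, lam < τ → Summable fun k => if ‖d k‖ ≤ ε then ‖d k‖ ^ τ else 0)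
    (hangle : 0 < lam → ∃ s : ℝ, s < Real.pi / (2 * lam) ∧
      ∀ k, ‖d k‖ ≤ ε → |Complex.arg (d k)| ≤ s) :
    ∃ τ s m δ : ℝ, lam < τ ∧ 0 < s ∧ s ≤ Real.pi / 2 ∧ τ * s < Real.pi / 2 ∧ 0 < m ∧ 0 < δ ∧
      ∀ u, 0 < ‖u‖ → ‖u‖ < δ → s ≤ |Complex.arg u| → (∀ k, u ≠ d k) →
        m ≤ ‖cauchySum a d u‖ := by
  have hpi := Real.pi_pos
  have hS : ∀ u, 0 < ‖u‖ → ‖u‖ < ε / 2 → (∀ k, u ≠ d k) →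
      Summable fun k => (a k : ℂ) / (d k - u) := fun u =>
    summable_div_sub_s19 ha hsum hd (by linarith) (hconv (lam + 1) (by linarith))
  rcases lt_or_ge lam 1 with h1 | h1
  · obtain ⟨τ, hτ, hτ1⟩ := exists_between h1
    have hm : 0 < a 0 * ((d 0).re / (‖d 0‖ + 1) ^ 2) := by
      have := ha 0; have := hd 0; positivity
    refine ⟨τ, Real.pi / 2, _, min (ε / 2) 1, hτ, by positivity, le_rfl, by nlinarith, hm,
      by positivity, fun u hu hu1 hu2 hne => ?_⟩
    rw [lt_min_iff] at hu1
    refine le_norm_cauchySum_of_re_nonpos ha hd ?_ hu1.2.le (hS u hu hu1.1 hne)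
    by_contra! hre
    exact not_lt.2 hu2 (Complex.abs_arg_lt_pi_div_two_iff.2 (Or.inl hre))
  · have hlam0 : 0 < lam := by linarith
    obtain ⟨s₀, hs₀, harg⟩ := hangle hlam0
    obtain ⟨s, hs1, hs2⟩ := exists_between (max_lt hs₀ (by positivity : 0 < Real.pi / (2 * lam)))
    have hs : 0 < s := (le_max_right _ _).trans_lt hs1
    have hs3 : lam * s < Real.pi / 2 := by
      rw [lt_div_iff₀ (by positivity)] at hs2
      linarith
    obtain ⟨τ, hτ, hτ1⟩ := exists_between ((lt_div_iff₀ hs).2 hs3)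
    have hsπ : s ≤ Real.pi / 2 := by nlinarith
    obtain ⟨m, hm, hev⟩ := exists_le_norm_cauchySum_of_sector ha hsum hd hε
      (le_max_right s₀ 0) hs1 hsπ (fun k hk => (harg k hk).trans (le_max_left _ _)) hS
    rw [eventually_nhdsWithin_iff, Metric.eventually_nhds_iff] at hev
    obtain ⟨δ, hδ, hev⟩ := hev
    exact ⟨τ, s, m, δ, hτ, hs, hsπ, (lt_div_iff₀ hs).1 hτ1, hm, hδ, fun u hu hu1 hu2 _ =>
      hev (by rwa [dist_zero_right]) ⟨norm_pos_iff.1 hu, hu2⟩⟩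

/-- A **Gauss-Lucas** type statement: the zeros of `∑ a k / (w - z k)` lie in every open convex set
containing all the `z k`. -/
theorem mem_of_tsum_div_sub_eq_zero {D : Set ℂ} (hDc : Convex ℝ D) (hDo : IsOpen D)
    {z : ℕ → ℂ} (hz : ∀ k, z k ∈ D) {a : ℕ → ℝ} (ha : ∀ k, 0 < a k) {w : ℂ}
    (hS : Summable fun k => (a k : ℂ) / (w - z k)) (h0 : ∑' k, (a k : ℂ) / (w - z k) = 0) :
    w ∈ D := by
  by_contra hw
  obtain ⟨f, hf⟩ := geometric_hahn_banach_open_point hDc hDo hw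
  have hne : ∀ k, w - z k ≠ 0 := fun k h => hw (sub_eq_zero.1 h ▸ hz k)
  have hterm : ∀ k, f ((starRingEnd ℂ) ((a k : ℂ) / (w - z k))) =
      a k / ‖w - z k‖ ^ 2 * f (w - z k) := by
    intro k
    have : (starRingEnd ℂ) ((a k : ℂ) / (w - z k)) = (a k / ‖w - z k‖ ^ 2) • (w - z k) := by
      rw [div_eq_mul_inv, Complex.inv_def, Complex.normSq_eq_norm_sq, Complex.real_smul]
      simp
      ring
    rw [this, map_smul, smul_eq_mul]
  have hpos : ∀ k, 0 < f ((starRingEnd ℂ) ((a k : ℂ) / (w - z k))) := by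
    intro k
    rw [hterm, map_sub]
    exact mul_pos (div_pos (ha k) (pow_pos (norm_pos_iff.2 (hne k)) 2))
      (sub_pos.2 (hf _ (hz k)))
  have hsum := hS.hasSum
  rw [h0] at hsum
  have hsum' : HasSum (fun k => f ((starRingEnd ℂ) ((a k : ℂ) / (w - z k)))) 0 := by
    simpa using (f.comp (Complex.conjCLE : ℂ →L[ℝ] ℂ)).hasSum hsum
  exact (hsum'.summable.tsum_pos (fun k => (hpos k).le) 0 (hpos 0)).ne' hsum'.tsum_eq

/-- Main theorem: let D ⊆ {Re z < 1} be a convex domain with 1 ∈ ∂D, z_k ∈ D,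
a_k > 0, ∑ a_k < ∞, 1 a limit point of {z_k}; suppose there are ε > 0, λ ≥ 0 with
∑_{|1-z_k| ≤ ε} |1 - z_k|^τ < ∞ for all τ > λ, and (if λ > 0)
sup{|arg(1-z_k)| : |1-z_k| ≤ ε} < π/(2λ). Then f(z) = ∑ a_k/(z - z_k) has a
sequence of zeros η_j ∈ D with η_j → 1. -/
theorem stmt_19
    (D : Set ℂ) (hDc : Convex ℝ D) (hDo : IsOpen D)
    (hDsub : D ⊆ {ζ : ℂ | ζ.re < 1}) (hbd : (1 : ℂ) ∈ frontier D)
    (z : ℕ → ℂ) (hz : ∀ k, z k ∈ D)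
    (a : ℕ → ℝ) (hpos : ∀ k, 0 < a k) (hsum : Summable a)
    (hlim : (1 : ℂ) ∈ closure (Set.range z))
    (ε lam : ℝ) (hε : 0 < ε) (hlam : 0 ≤ lam)
    (hconv : ∀ τ : ℝ, lam < τ →
      Summable (fun k => if ‖1 - z k‖ ≤ ε then ‖1 - z k‖ ^ τ else 0))
    (hangle : 0 < lam → ∃ s : ℝ, s < Real.pi / (2 * lam) ∧
      ∀ k, ‖1 - z k‖ ≤ ε → |Complex.arg (1 - z k)| ≤ s) :
    ∃ η : ℕ → ℂ,
      Tendsto η atTop (nhds 1) ∧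
      ∀ j, η j ∈ D ∧ (∀ k, η j ≠ z k) ∧
        Summable (fun k => (a k : ℂ) / (η j - z k)) ∧
        (∑' k, (a k : ℂ) / (η j - z k)) = 0 := by
  have hd : ∀ k, 0 < (1 - z k).re := fun k => by
    have : (z k).re < 1 := hDsub (hz k)
    rw [Complex.sub_re, Complex.one_re]
    linarith
  obtain ⟨τ, s, m, δ, hτ, hs, hsπ, hτs, hm, hδ, hoff⟩ :=
    exists_sector_bound (d := fun k => 1 - z k) hpos hsum hd hε hlam hconv hangle
  have hτ0 : 0 < τ := hlam.trans_lt hτ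
  have hlim0 : (0 : ℂ) ∈ closure (Set.range fun k => 1 - z k) := by
    have h1 := image_closure_subset_closure_image
      (continuous_const.sub continuous_id : Continuous fun w : ℂ => 1 - w)
      (Set.mem_image_of_mem _ hlim)
    rw [← Set.range_comp] at h1
    simpa [Function.comp_def] using h1
  have hzero : ∀ j : ℕ, ∃ w : ℂ, ‖w - 1‖ < 1 / ((j : ℝ) + 1) ∧ w ∈ D ∧ (∀ k, w ≠ z k) ∧
      Summable (fun k => (a k : ℂ) / (w - z k)) ∧ ∑' k, (a k : ℂ) / (w - z k) = 0 := by
    intro j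
    have hj : (0 : ℝ) < 1 / ((j : ℝ) + 1) := by positivity
    have hδε : min (min δ (ε / 2)) (1 / ((j : ℝ) + 1)) ≤ ε / 2 :=
      (min_le_left _ _).trans (min_le_right _ _)
    obtain ⟨u, hu, huδ, hne, h0⟩ := exists_cauchySum_eq_zero hpos hsum hd hτ0 (hconv τ hτ) hlim0
      (by positivity) hδε hs hsπ hτs hm
      (fun u h1 h2 => hoff u h1 (h2.trans_le ((min_le_left _ _).trans (min_le_left _ _))))
    have hS := summable_div_sub_s19 hpos hsum hd hτ0 (hconv τ hτ) hu (huδ.trans_le hδε) hne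
    have hsub : ∀ k, 1 - z k - u = 1 - u - z k := fun k => by ring
    simp only [cauchySum, hsub] at h0 hS
    refine ⟨1 - u, ?_, mem_of_tsum_div_sub_eq_zero hDc hDo hz hpos hS h0, fun k hk => ?_, hS, h0⟩
    · rw [sub_sub_cancel_left, norm_neg]
      exact huδ.trans_le (min_le_right _ _)
    · exact hne k (by rw [← hk]; ring)
  choose η hη1 hη using hzero
  refine ⟨η, ?_, hη⟩
  rw [tendsto_iff_norm_sub_tendsto_zero]
  exact squeeze_zero (fun _ => norm_nonneg _) (fun j => (hη1 j).le)
    tendsto_one_div_add_atTop_nhds_zero_nat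
end
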